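/- Let p be an odd prime, and let A, k, n be integers with |A| < p/2, p ∤ A, 1 ≤ k < p−1, gcd(k, p−1) = 1 and 2 ≤ n < p. Suppose d = gcd(k−1, p−1) ≤ 0.006·p^{89/92}. If p > 4·10^{29}·n^{184/3}, then for every pair i, j with 0 ≤ i, j ≤ n−1 one has f(I_i) ∩ I_j ≠ ∅. -/

import Mathlib

/-- `Iclass p n j` is the residue class `I_j = {x : 1 ≤ x ≤ p-1, x ≡ j (mod n)}`. -/
def Iclass (p n j : ℕ) : Finset ℕ :=
  (Finset.Icc 1 (p - 1)).filter fun x => x % n = j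

/-- `fmap p A k x` is `A x^k mod p`, the least residue in `{0, …, p-1}`. -/
def fmap (p : ℕ) (A : ℤ) (k : ℕ) (x : ℕ) : ℕ :=
  ((A : ZMod p) * (x : ZMod p) ^ k).val

section

open Polynomial

/-- Keep the monomials of `P` whose exponent is congruent to `e` modulo `s`. -/
noncomputable def classPart {K : Type*} [Field K] (s e : ℕ) (P : K[X]) : K[X] :=
  ∑ n ∈ P.support.filter (fun n => n % s = e), monomial n (P.coeff n)

lemma coeff_classPart {K : Type*} [Field K] (s e : ℕ) (P : K[X]) (m : ℕ) :
    (classPart s e P).coeff m = if m % s = e then P.coeff m else 0 := by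
  classical
  unfold classPart
  simp only [finsetSum_coeff, coeff_monomial]
  rw [Finset.sum_ite_eq' ]
  simp only [Finset.mem_filter, mem_support_iff]
  split_ifs with h1 h2 h2 <;> simp_all

lemma classPart_sum {K ι : Type*} [Field K] (s e : ℕ) (I : Finset ι) (w : ι → K[X]) :
    classPart s e (∑ i ∈ I, w i) = ∑ i ∈ I, classPart s e (w i) := by
  ext m
  simp only [coeff_classPart, finsetSum_coeff]
  split_ifs <;> simp

lemma sum_classPart {K : Type*} [Field K] {s : ℕ} (hs : 0 < s) (P : K[X]) :
    ∑ e ∈ Finset.range s, classPart s e P = P := by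
  ext m
  simp [coeff_classPart, Nat.mod_lt m hs]

lemma classPart_binomial_mul {K : Type*} [Field K] (s e : ℕ) (β : K) (P : K[X]) :
    classPart s e ((1 - C β * X ^ s) * P) = (1 - C β * X ^ s) * classPart s e P := by
  ext m
  rw [coeff_classPart]
  simp only [sub_mul, one_mul, coeff_sub, mul_assoc, coeff_C_mul, coeff_X_pow_mul',
    coeff_classPart]
  by_cases hm : s ≤ m
  · have : (m - s) % s = m % s := by
      conv_rhs => rw [← Nat.sub_add_cancel hm]
      simp
    simp only [hm, if_true, this]
    split_ifs <;> simp
  · simp [hm]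

lemma binomial_pow_dvd_classPart {K : Type*} [Field K] {s t : ℕ} (e : ℕ) {β : K} {P : K[X]}
    (h : (1 - C β * X ^ s) ^ t ∣ P) : (1 - C β * X ^ s) ^ t ∣ classPart s e P := by
  obtain ⟨Q, rfl⟩ := h
  refine ⟨classPart s e Q, ?_⟩
  induction t generalizing Q with
  | zero => simp
  | succ t ih => rw [pow_succ, mul_assoc, ih, classPart_binomial_mul, mul_assoc]

/-- If `W i` are eigenvectors of the Euler operator with distinct eigenvalues, a high power of
`h` dividing their sum forces `h` to divide each of them. -/
lemma dvd_of_pow_card_dvd_sum {K : Type*} [Field K] (h : K[X]) (I : Finset ℕ)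
    (hI : Set.InjOn (fun i : ℕ => (i : K)) I) (w : ℕ → K[X])
    (hw : ∀ i ∈ I, X * derivative (w i) = C (i : K) * w i)
    (hdvd : h ^ I.card ∣ ∑ i ∈ I, w i) : ∀ i ∈ I, h ∣ w i := by
  classical
  induction I using Finset.induction_on generalizing w with
  | empty => simp
  | insert a I ha ih =>
    have key : ∀ i ∈ I, h ∣ w i := by
      intro i hi
      have h1 : h ^ I.card ∣ X * derivative (∑ i ∈ insert a I, w i)
          - C (a : K) * ∑ i ∈ insert a I, w i := by
        rw [Finset.card_insert_of_notMem ha] at hdvd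
        refine dvd_sub (Dvd.dvd.mul_left ?_ _) (Dvd.dvd.mul_left ?_ _)
        · simpa using pow_sub_one_dvd_derivative_of_pow_dvd hdvd
        · exact (pow_dvd_pow _ (Nat.le_succ _)).trans hdvd
      have h2 : X * derivative (∑ i ∈ insert a I, w i)
          - C (a : K) * ∑ i ∈ insert a I, w i = ∑ i ∈ I, C ((i : K) - a) * w i := by
        rw [derivative_sum, Finset.mul_sum, Finset.mul_sum, ← Finset.sum_sub_distrib,
          Finset.sum_insert ha, hw a (Finset.mem_insert_self _ _), sub_self, zero_add]
        refine Finset.sum_congr rfl fun j hj => ?_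
        rw [hw j (Finset.mem_insert_of_mem hj), C_sub, sub_mul]
      rw [h2] at h1
      have h3 := ih (hI.mono (by simp)) (fun i => C ((i : K) - a) * w i) ?_ h1 i hi
      · have hne : (i : K) - a ≠ 0 := by
          intro h0
          have := hI (by simp [hi]) (by simp) (sub_eq_zero.mp h0)
          exact ha (this ▸ hi)
        have hu : IsUnit (C ((i : K) - a)) := isUnit_C.mpr (Ne.isUnit hne)
        exact (hu.dvd_mul_left).mp h3
      · intro j hj
        rw [derivative_C_mul, mul_left_comm, hw j (Finset.mem_insert_of_mem hj)]
        ring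
    intro i hi
    rcases Finset.mem_insert.mp hi with rfl | hi
    · have h1 : h ∣ ∑ i ∈ insert i I, w i := by
        refine dvd_trans ?_ hdvd
        exact dvd_pow_self _ (by simp)
      rw [Finset.sum_insert ha] at h1
      exact (dvd_add_left (Finset.dvd_sum key)).mp h1
    · exact key i hi

lemma card_filter_add_mod_le (s M c e : ℕ) :
    ((Finset.range (M * s)).filter fun i => (i + c) % s = e).card ≤ M := by
  conv_rhs => rw [← Finset.card_range M]
  refine Finset.card_le_card_of_injOn (fun i => i / s) ?_ ?_
  · intro i hi
    simp only [Finset.coe_filter, Finset.mem_range, Set.mem_ofPred_eq] at hi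
    simpa using Nat.div_lt_of_lt_mul (by rw [mul_comm]; exact hi.1)
  · intro i hi j hj hij
    simp only [Finset.coe_filter, Finset.mem_range, Set.mem_ofPred_eq] at hi hj
    have h1 : i ≡ j [MOD s] := Nat.ModEq.add_right_cancel' c (hi.2.trans hj.2.symm)
    rw [← Nat.div_add_mod i s, ← Nat.div_add_mod j s, h1]
    simp only at hij
    rw [hij]

lemma natCast_zmod_injOn {p : ℕ} : Set.InjOn (fun i : ℕ => (i : ZMod p)) (Set.Iio p) := by
  intro a ha b hb hab
  simp only at hab
  rw [ZMod.natCast_eq_natCast_iff'] at hab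
  rwa [Nat.mod_eq_of_lt ha, Nat.mod_eq_of_lt hb] at hab

lemma separable_binomial {p : ℕ} [Fact p.Prime] {s : ℕ} (hs : 0 < s) (hsp : s < p) {β : ZMod p}
    (hβ : β ≠ 0) : (1 - C β * X ^ s : (ZMod p)[X]).Separable := by
  have hs0 : (s : ZMod p) ≠ 0 := by
    rw [Ne, ZMod.natCast_eq_zero_iff]
    exact Nat.not_dvd_of_pos_of_lt hs hsp
  have h := separable_X_pow_sub_C (β⁻¹) hs0 (inv_ne_zero hβ)
  have : (1 - C β * X ^ s : (ZMod p)[X]) = C (-β) * (X ^ s - C β⁻¹) := by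
    rw [mul_sub, ← C_mul]
    simp [hβ]
    ring
  rw [this]
  exact Separable.unit_mul (isUnit_C.mpr (neg_ne_zero.mpr hβ).isUnit) h

lemma isCoprime_binomial_X {K : Type*} [Field K] {s : ℕ} (hs : 0 < s) (β : K) :
    IsCoprime (1 - C β * X ^ s : K[X]) X := by
  refine ⟨1, C β * X ^ (s - 1), ?_⟩
  rw [mul_assoc, ← pow_succ, Nat.sub_add_cancel hs]
  ring

/-- A high power of `1 - β X ^ s` dividing a lacunary polynomial divides all its parts. -/
lemma binomial_dvd_of_pow_dvd_sum_expand {p : ℕ} [Fact p.Prime] {s t M : ℕ} {β : ZMod p}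
    (hβ : β ≠ 0) (hs : 0 < s) (hsp : s < p) (hMs : M * s ≤ p) (g : ℕ → (ZMod p)[X])
    (E : Finset ℕ) (hE : ∀ i, (g i).support ⊆ E) (ht : M * E.card ≤ t)
    (hdvd : (1 - C β * X ^ s) ^ t ∣ ∑ i ∈ Finset.range (M * s), X ^ i * expand (ZMod p) p (g i)) :
    ∀ i < M * s, (1 - C β * X ^ s) ∣ g i := by
  classical
  have hp := (Fact.out : p.Prime)
  set w : ℕ → ℕ → (ZMod p)[X] := fun e i => classPart s e (X ^ i * expand (ZMod p) p (g i))
    with hw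
  have hcoeff : ∀ i e m, (w e i).coeff m ≠ 0 →
      m % s = e ∧ ∃ j ∈ E, m = i + p * j := by
    intro i e m hm
    simp only [hw] at hm
    rw [coeff_classPart] at hm
    have h1 : m % s = e := by by_contra h0; simp [h0] at hm
    rw [if_pos h1, coeff_X_pow_mul'] at hm
    have h2 : i ≤ m := by by_contra h0; simp [h0] at hm
    rw [if_pos h2, coeff_expand hp.pos] at hm
    have h3 : p ∣ m - i := by by_contra h0; simp [h0] at hm
    rw [if_pos h3] at hm
    refine ⟨h1, (m - i) / p, hE i (mem_support_iff.mpr hm), ?_⟩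
    rw [Nat.mul_div_cancel' h3]; omega
  have hpart : ∀ i < M * s, ∀ e, (1 - C β * X ^ s) ∣ w e i := by
    intro i hi e
    set I := (Finset.range (M * s)).filter fun i => ∃ j ∈ E, (i + p * j) % s = e with hI
    have hcard : I.card ≤ t := by
      refine le_trans ?_ ht
      have : I ⊆ E.biUnion fun j => (Finset.range (M * s)).filter fun i => (i + p * j) % s = e := by
        intro i hi
        simp only [hI, Finset.mem_filter, Finset.mem_biUnion] at hi ⊢
        obtain ⟨h1, j, h2, h3⟩ := hi
        exact ⟨j, h2, h1, h3⟩
      refine (Finset.card_le_card this).trans ?_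
      rw [mul_comm M E.card]
      exact Finset.card_biUnion_le_card_mul _ _ _ fun j _ => card_filter_add_mod_le s M _ e
    have hzero : ∀ i < M * s, i ∉ I → w e i = 0 := by
      intro i hi hiI
      ext m
      by_contra hm
      obtain ⟨h1, j, hj, rfl⟩ := hcoeff i e m hm
      exact hiI (by simp only [hI, Finset.mem_filter, Finset.mem_range]; exact ⟨hi, j, hj, h1⟩)
    by_cases hiI : i ∈ I
    swap
    · rw [hzero i hi hiI]; exact dvd_zero _
    refine dvd_of_pow_card_dvd_sum _ I ?_ (w e) ?_ ?_ i hiI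
    · refine natCast_zmod_injOn.mono fun a ha => ?_
      have := Finset.mem_range.mp (Finset.mem_filter.mp ha).1
      exact Set.mem_Iio.mpr (by omega)
    · intro i _
      ext m
      rw [coeff_C_mul]
      rcases m with _ | m
      · simp only [mul_coeff_zero, coeff_X_zero, zero_mul]
        by_contra hm
        obtain ⟨-, j, -, hj⟩ := hcoeff i e 0 (fun h0 => hm (by rw [h0, mul_zero]))
        have : i = 0 := by omega
        exact hm (by simp [this])
      · rw [coeff_X_mul, coeff_derivative]
        by_cases hm : (w e i).coeff (m + 1) = 0
        · rw [hm]; simp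
        · obtain ⟨-, j, -, hj⟩ := hcoeff i e _ hm
          have : ((m : ZMod p) + 1) = i := by
            have := congrArg (Nat.cast (R := ZMod p)) hj
            simpa using this
          rw [this, mul_comm]
    · refine (pow_dvd_pow _ hcard).trans ?_
      have h1 := binomial_pow_dvd_classPart e hdvd
      rw [classPart_sum] at h1
      refine h1.trans (dvd_of_eq (Eq.symm ?_))
      refine Finset.sum_subset (Finset.filter_subset _ _) fun i hi hiI => ?_
      exact hzero i (Finset.mem_range.mp hi) hiI
  intro i hi
  have h1 : (1 - C β * X ^ s) ∣ X ^ i * expand (ZMod p) p (g i) := by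
    rw [← sum_classPart hs (X ^ i * expand (ZMod p) p (g i))]
    exact Finset.dvd_sum fun e _ => hpart i hi e
  have h2 : (1 - C β * X ^ s) ∣ expand (ZMod p) p (g i) :=
    ((isCoprime_binomial_X hs β).pow_right).dvd_of_dvd_mul_left h1
  rw [ZMod.expand_card] at h2
  exact ((separable_binomial hs hsp hβ).squarefree.dvd_pow_iff_dvd hp.ne_zero).mp h2

/-- The derivation `P ↦ r P'` twisted by multiplication by `a`. -/
noncomputable def twistedDeriv {K : Type*} [Field K] (r a : K[X]) : Module.End K K[X] :=
  LinearMap.mulLeft K r ∘ₗ derivative + LinearMap.mulLeft K a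

lemma twistedDeriv_apply {K : Type*} [Field K] (r a P : K[X]) :
    twistedDeriv r a P = r * derivative P + a * P := rfl

lemma eval_twistedDeriv_pow_X_sub_C_pow_mul {K : Type*} [Field K] (r : K[X]) (u : K) (k : ℕ) :
    ∀ q : K[X], ((twistedDeriv r 0 ^ k) ((X - C u) ^ k * q)).eval u
      = (k.factorial : K) * r.eval u ^ k * q.eval u := by
  induction k with
  | zero => simp
  | succ k ih =>
    intro q
    have h : twistedDeriv r 0 ((X - C u) ^ (k + 1) * q) = (X - C u) ^ k *
        (((k : K[X]) + 1) * r * q + (X - C u) * r * derivative q) := by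
      rw [twistedDeriv_apply]
      simp only [derivative_mul, derivative_X_sub_C_pow, zero_mul, add_zero]
      simp
      ring
    rw [pow_succ, Module.End.mul_apply, h, ih]
    simp [Nat.factorial_succ]
    ring

lemma X_sub_C_pow_dvd_of_eval_twistedDeriv_pow {p : ℕ} [Fact p.Prime] (r Q : (ZMod p)[X])
    (u : ZMod p) (M : ℕ) (hM : M ≤ p) (hr : r.eval u ≠ 0)
    (h : ∀ m < M, ((twistedDeriv r 0 ^ m) Q).eval u = 0) : (X - C u) ^ M ∣ Q := by
  have : ∀ n ≤ M, (X - C u) ^ n ∣ Q := by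
    intro n
    induction n with
    | zero => simp
    | succ n ih =>
      intro hn
      obtain ⟨q, hq⟩ := ih (by omega)
      have h1 := h n (by omega)
      rw [hq, eval_twistedDeriv_pow_X_sub_C_pow_mul] at h1
      have h2 : (n.factorial : ZMod p) ≠ 0 := by
        rw [Ne, ZMod.natCast_eq_zero_iff, (Fact.out : p.Prime).dvd_factorial]
        omega
      have h3 : q.eval u = 0 := by
        rcases mul_eq_zero.mp h1 with h | h
        · exact absurd h (mul_ne_zero h2 (pow_ne_zero _ hr))
        · exact h
      obtain ⟨q', hq'⟩ := dvd_iff_isRoot.mpr h3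
      exact ⟨q', by rw [hq, hq', pow_succ, mul_assoc]⟩
  exact this M le_rfl

lemma twistedDeriv_pow_mul {K : Type*} [Field K] {r a Y : K[X]} (hY : r * derivative Y = a * Y)
    (m : ℕ) : ∀ P : K[X], (twistedDeriv r 0 ^ m) (P * Y) = (twistedDeriv r a ^ m) P * Y := by
  induction m with
  | zero => simp
  | succ m ih =>
    intro P
    have : twistedDeriv r 0 (P * Y) = twistedDeriv r a P * Y := by
      rw [twistedDeriv_apply, twistedDeriv_apply, derivative_mul]
      linear_combination P * hY
    rw [pow_succ, Module.End.mul_apply, this, ih, pow_succ, Module.End.mul_apply]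

lemma natDegree_twistedDeriv_pow_le {K : Type*} [Field K] {r a : K[X]} {ρ : ℕ}
    (hr : r.natDegree ≤ ρ + 1) (ha : a.natDegree ≤ ρ) (m : ℕ) :
    ∀ P : K[X], ((twistedDeriv r a ^ m) P).natDegree ≤ P.natDegree + ρ * m := by
  induction m with
  | zero => simp
  | succ m ih =>
    intro P
    rw [pow_succ, Module.End.mul_apply]
    refine (ih _).trans ?_
    have : (twistedDeriv r a P).natDegree ≤ P.natDegree + ρ := by
      rw [twistedDeriv_apply]
      refine natDegree_add_le_of_degree_le ?_ ?_
      · rcases Nat.eq_zero_or_pos P.natDegree with h0 | h0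
        · rw [natDegree_eq_zero.mp h0 |>.choose_spec.symm]
          simp
        · refine natDegree_mul_le.trans ?_
          have := natDegree_derivative_le P
          omega
      · refine natDegree_mul_le.trans ?_
        omega
    rw [mul_add]
    omega

lemma mul_derivative_pow {K : Type*} [Field K] {r a f : K[X]} (hf : r * derivative f = a * f)
    (n : ℕ) : r * derivative (f ^ n) = (n : K[X]) * a * f ^ n := by
  rcases n with _ | n
  · simp
  · rw [derivative_pow_succ]
    simp only [map_add, map_natCast, map_one, Nat.cast_add, Nat.cast_one]
    linear_combination (((n : K[X]) + 1) * f ^ n) * hf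

/-- **Stepanov's method**, for the points where `f₁ = c f₂`. -/
lemma stepanov {p : ℕ} [Fact p.Prime] {f₁ f₂ r a₁ a₂ : (ZMod p)[X]} {ρ Δ M A B N : ℕ} {c : ZMod p}
    (hf₁ : r * derivative f₁ = a₁ * f₁) (hf₂ : r * derivative f₂ = a₂ * f₂)
    (hr : r.natDegree ≤ ρ + 1) (ha₁ : a₁.natDegree ≤ ρ) (ha₂ : a₂.natDegree ≤ ρ)
    (hd₁ : f₁.natDegree ≤ Δ) (hd₂ : f₂.natDegree ≤ Δ) (hM : M ≤ p)
    (hcond : M * (A + B + ρ * M) < A * B * N)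
    (hind : LinearIndependent (ZMod p) fun x : Fin N × Fin A × Fin B =>
      (X ^ (x.2.1 : ℕ) * (X ^ (p * x.2.2) * f₁ ^ (x.1 : ℕ) * f₂ ^ (N - 1 - x.1)) : (ZMod p)[X]))
    (Z : Finset (ZMod p)) (hZ : ∀ u ∈ Z, f₁.eval u = c * f₂.eval u ∧ r.eval u ≠ 0) :
    M * Z.card ≤ A - 1 + p * (B - 1) + Δ * (N - 1) := by
  classical
  set D := A + B + ρ * M with hD
  set tw : ℕ → (ZMod p)[X] := fun l => (l : (ZMod p)[X]) * a₁ + ((N - 1 - l : ℕ) : (ZMod p)[X]) * a₂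
    with htw
  have htwdeg : ∀ l, (tw l).natDegree ≤ ρ := by
    intro l
    refine natDegree_add_le_of_degree_le ?_ ?_
    · refine natDegree_mul_le.trans ?_
      rw [natDegree_natCast]; omega
    · refine natDegree_mul_le.trans ?_
      rw [natDegree_natCast]; omega
  set T : ℕ → Fin N × Fin A × Fin B → (ZMod p)[X] := fun m x =>
    C (c ^ (x.1 : ℕ)) * (twistedDeriv r (tw x.1) ^ m) (X ^ (x.2.1 : ℕ)) * X ^ (x.2.2 : ℕ) with hT
  have hTdeg : ∀ m < M, ∀ x, (T m x).natDegree < D := by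
    intro m hm x
    have h1 := natDegree_twistedDeriv_pow_le hr (htwdeg x.1) m (X ^ (x.2.1 : ℕ))
    rw [natDegree_X_pow] at h1
    have h2 : (T m x).natDegree ≤ ((twistedDeriv r (tw x.1) ^ m) (X ^ (x.2.1 : ℕ))).natDegree
        + (x.2.2 : ℕ) := by
      refine natDegree_mul_le.trans ?_
      rw [natDegree_X_pow]
      exact Nat.add_le_add_right (natDegree_C_mul_le _ _) _
    have h3 := x.2.1.isLt
    have h4 := x.2.2.isLt
    have h5 : ρ * m ≤ ρ * M := Nat.mul_le_mul_left _ hm.le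
    omega
  have hdep : ¬ LinearIndependent (ZMod p) fun (x : Fin N × Fin A × Fin B) (y : Fin M × Fin D) =>
      (T y.1 x).coeff y.2 := by
    intro h
    have := h.fintype_card_le_finrank
    simp only [Fintype.card_prod, Fintype.card_fin, Module.finrank_fintype_fun_eq_card] at this
    have h2 : N * (A * B) = A * B * N := by ring
    omega
  obtain ⟨lam, hlam, x₀, hx₀⟩ := Fintype.not_linearIndependent_iff.mp hdep
  have hT0 : ∀ m < M, ∑ x, lam x • T m x = 0 := by
    intro m hm
    ext d
    rw [finsetSum_coeff, coeff_zero]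
    by_cases hd : d < D
    · have := congrFun hlam (⟨m, hm⟩, ⟨d, hd⟩)
      simpa using this
    · refine Finset.sum_eq_zero fun x _ => ?_
      rw [coeff_smul, coeff_eq_zero_of_natDegree_lt (by have := hTdeg m hm x; omega), smul_zero]
  set Y : Fin N × Fin A × Fin B → (ZMod p)[X] := fun x =>
    X ^ (p * x.2.2) * f₁ ^ (x.1 : ℕ) * f₂ ^ (N - 1 - x.1) with hY
  have hYd : ∀ x, r * derivative (Y x) = tw x.1 * Y x := by
    intro x
    have h1 := mul_derivative_pow hf₁ x.1
    have h2 := mul_derivative_pow hf₂ (N - 1 - x.1)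
    have h3 : derivative (X ^ (p * (x.2.2 : ℕ)) : (ZMod p)[X]) = 0 := by
      rw [derivative_X_pow]; simp
    simp only [hY, htw]
    rw [derivative_mul, derivative_mul, h3]
    linear_combination (X ^ (p * (x.2.2 : ℕ)) * f₂ ^ (N - 1 - x.1)) * h1 +
      (X ^ (p * (x.2.2 : ℕ)) * f₁ ^ (x.1 : ℕ)) * h2
  set Ps : (ZMod p)[X] := ∑ x, lam x • (X ^ (x.2.1 : ℕ) * Y x) with hPs
  have hPs0 : Ps ≠ 0 := fun h => hx₀ (Fintype.linearIndependent_iff.mp hind lam h x₀)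
  have heval : ∀ u ∈ Z, ∀ m < M, ((twistedDeriv r 0 ^ m) Ps).eval u = 0 := by
    intro u hu m hm
    have h0 : ((∑ x, lam x • T m x).eval u) * f₂.eval u ^ (N - 1) = 0 := by
      rw [hT0 m hm]; simp
    rw [← h0, hPs, map_sum, eval_finsetSum, eval_finsetSum, Finset.sum_mul]
    refine Finset.sum_congr rfl fun x _ => ?_
    rw [map_smul, twistedDeriv_pow_mul (hYd x)]
    have h5 : f₂.eval u ^ (N - 1) = f₂.eval u ^ (x.1 : ℕ) * f₂.eval u ^ (N - 1 - (x.1 : ℕ)) := by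
      rw [← pow_add]; congr 1; have := x.1.isLt; omega
    simp only [hY, hT, eval_smul, eval_mul, eval_pow, eval_X, eval_C, pow_mul, ZMod.pow_card,
      (hZ u hu).1, h5, mul_pow, smul_eq_mul]
    ring
  have hdvd : ∏ u ∈ Z, (X - C u) ^ M ∣ Ps := by
    refine Finset.prod_dvd_of_coprime ?_ fun u hu =>
      X_sub_C_pow_dvd_of_eval_twistedDeriv_pow r Ps u M hM (hZ u hu).2 (heval u hu)
    intro u _ v _ huv
    exact (isCoprime_X_sub_C_of_isUnit_sub (sub_ne_zero.mpr huv).isUnit).pow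
  have hdeg := natDegree_le_of_dvd hdvd hPs0
  have hprod : (∏ u ∈ Z, (X - C u) ^ M).natDegree = M * Z.card := by
    rw [natDegree_prod _ _ fun u _ => pow_ne_zero _ (X_sub_C_ne_zero u)]
    simp [natDegree_pow, mul_comm]
  rw [hprod] at hdeg
  refine hdeg.trans (natDegree_sum_le_of_forall_le _ _ fun x _ => ?_)
  refine (natDegree_smul_le _ _).trans (natDegree_mul_le.trans ?_)
  rw [natDegree_X_pow]
  have h1 : (Y x).natDegree ≤ p * x.2.2 + x.1 * Δ + (N - 1 - x.1) * Δ := by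
    refine natDegree_mul_le.trans (Nat.add_le_add (natDegree_mul_le.trans (Nat.add_le_add ?_ ?_)) ?_)
    · rw [natDegree_X_pow]
    · exact natDegree_pow_le.trans (Nat.mul_le_mul_left _ hd₁)
    · exact natDegree_pow_le.trans (Nat.mul_le_mul_left _ hd₂)
  have h2 : (x.1 : ℕ) * Δ + (N - 1 - x.1) * Δ = Δ * (N - 1) := by
    rw [← add_mul, mul_comm]; congr 1; have := x.1.isLt; omega
  have h3 : p * (x.2.2 : ℕ) ≤ p * (B - 1) := Nat.mul_le_mul_left _ (by have := x.2.2.isLt; omega)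
  have h4 := x.2.1.isLt
  omega

lemma eq_zero_of_sum_mul_pow_mul_pow {R : Type*} [CommRing R] [IsDomain R] {f₁ f₂ : R}
    (hf₁ : f₁ ≠ 0) {N : ℕ} {Q : ℕ → R}
    (h : ∀ l < N, f₁ ∣ Q l * f₂ ^ (N - 1 - l) → Q l = 0)
    (hsum : ∑ l ∈ Finset.range N, Q l * (f₁ ^ l * f₂ ^ (N - 1 - l)) = 0) : ∀ l < N, Q l = 0 := by
  intro l
  induction l using Nat.strong_induction_on with
  | _ l ih =>
    intro hl
    refine h l hl ?_
    rw [← Finset.add_sum_erase _ _ (Finset.mem_range.mpr hl)] at hsum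
    have h1 : f₁ ^ (l + 1) ∣ Q l * (f₁ ^ l * f₂ ^ (N - 1 - l)) := by
      rw [eq_neg_of_add_eq_zero_left hsum, dvd_neg]
      refine Finset.dvd_sum fun m hm => ?_
      obtain ⟨hm1, hm2⟩ := Finset.mem_erase.mp hm
      rcases lt_or_gt_of_ne hm1 with h0 | h0
      · rw [ih m h0 (Finset.mem_range.mp hm2)]; simp
      · exact Dvd.dvd.mul_left (Dvd.dvd.mul_right (pow_dvd_pow _ h0) _) _
    rw [pow_succ, mul_left_comm] at h1
    exact (mul_dvd_mul_iff_left (pow_ne_zero l hf₁)).mp h1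

/-- A divisibility criterion for the auxiliary monomials of Stepanov's method to be independent. -/
lemma linearIndependent_of_dvd {p : ℕ} [Fact p.Prime] {f₁ f₂ : (ZMod p)[X]} {A B N : ℕ}
    (hf₁ : f₁ ≠ 0)
    (h : ∀ (n : ℕ) (g : ℕ → (ZMod p)[X]), (∀ i, (g i).support ⊆ Finset.range B) →
      f₁ ∣ (∑ i ∈ Finset.range A, X ^ i * expand (ZMod p) p (g i)) * f₂ ^ n → ∀ i < A, g i = 0) :
    LinearIndependent (ZMod p) fun x : Fin N × Fin A × Fin B =>
      (X ^ (x.2.1 : ℕ) * (X ^ (p * x.2.2) * f₁ ^ (x.1 : ℕ) * f₂ ^ (N - 1 - x.1)) :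
        (ZMod p)[X]) := by
  classical
  rw [Fintype.linearIndependent_iff]
  intro lam hlam
  set g : ℕ → ℕ → (ZMod p)[X] := fun l i => ∑ b : Fin B,
    if hl : l < N ∧ i < A then monomial b (lam (⟨l, hl.1⟩, ⟨i, hl.2⟩, b)) else 0 with hg
  have hgs : ∀ l i, (g l i).support ⊆ Finset.range B := by
    intro l i m hm
    rw [mem_support_iff] at hm
    by_contra hmB
    apply hm
    simp only [hg, finsetSum_coeff]
    refine Finset.sum_eq_zero fun b _ => ?_
    split_ifs
    · rw [coeff_monomial, if_neg]
      intro hb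
      exact hmB (Finset.mem_range.mpr (hb ▸ b.isLt))
    · simp
  set Q : ℕ → (ZMod p)[X] := fun l => ∑ i ∈ Finset.range A, X ^ i * expand (ZMod p) p (g l i)
    with hQ
  have hcrit : ∀ l, ∀ n, f₁ ∣ Q l * f₂ ^ n → ∀ i < A, g l i = 0 := fun l n hd => h n (g l) (hgs l) hd
  have hQ0 : ∀ l < N, Q l = 0 := by
    refine eq_zero_of_sum_mul_pow_mul_pow (f₂ := f₂) hf₁ ?_ ?_
    · intro l _ hd
      refine Finset.sum_eq_zero fun i hi => ?_
      rw [hcrit l _ hd i (Finset.mem_range.mp hi)]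
      simp
    · rw [← hlam, Fintype.sum_prod_type, Finset.sum_range]
      refine Finset.sum_congr rfl fun l _ => ?_
      rw [Fintype.sum_prod_type, hQ]
      simp only
      rw [Finset.sum_range, Finset.sum_mul]
      refine Finset.sum_congr rfl fun i _ => ?_
      simp only [hg, l.isLt, i.isLt, and_self, dite_true, map_sum, Finset.mul_sum, Finset.sum_mul,
        ← C_mul_X_pow_eq_monomial, Fin.eta, smul_eq_C_mul]
      refine Finset.sum_congr rfl fun b _ => ?_
      rw [map_mul, expand_C, map_pow, expand_X, ← pow_mul]
      ring
  rintro ⟨l, i, b⟩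
  have h0 := hcrit l 0 (by rw [hQ0 l l.isLt]; simp) i i.isLt
  have h1 := congrArg (fun P => coeff P (b : ℕ)) h0
  simp only [hg, l.isLt, i.isLt, and_self, dite_true, finsetSum_coeff, coeff_monomial,
    coeff_zero, Fin.val_inj] at h1
  simpa using h1

lemma natDegree_binomial {K : Type*} [Field K] {s : ℕ} {β : K} (hβ : β ≠ 0) :
    (1 - C β * X ^ s : K[X]).natDegree = s ∨ s = 0 := by
  rcases Nat.eq_zero_or_pos s with h | h
  · exact Or.inr h
  left
  rw [sub_eq_add_neg, add_comm, natDegree_add_eq_left_of_natDegree_lt]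
  · rw [natDegree_neg, natDegree_C_mul_X_pow _ _ hβ]
  · rw [natDegree_neg, natDegree_C_mul_X_pow _ _ hβ]; simpa

lemma natDegree_binomial_le {K : Type*} [Field K] (s : ℕ) (β : K) :
    (1 - C β * X ^ s : K[X]).natDegree ≤ s :=
  (natDegree_sub_le _ _).trans (max_le (by simp) (natDegree_C_mul_X_pow_le _ _))

lemma binomial_ne_zero {K : Type*} [Field K] {s : ℕ} (hs : 0 < s) (β : K) :
    (1 - C β * X ^ s : K[X]) ≠ 0 := by
  intro h
  have := congrArg (eval 0) h
  simp [hs.ne'] at this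

/-- The common part of two distinct binomials is at most half of the larger one. -/
lemma exists_factor_binomial {p : ℕ} [Fact p.Prime] {s t : ℕ} {α β : ZMod p} (hα : α ≠ 0)
    (hβ : β ≠ 0) (ht : 0 < t) (hts : t ≤ s) (hsp : s < p) (hne : t = s → α ≠ β) :
    ∃ h₁ h₂ : (ZMod p)[X], 1 - C β * X ^ s = h₁ * h₂ ∧ h₁ ∣ 1 - C α * X ^ t ∧
      IsCoprime h₂ (1 - C α * X ^ t) ∧ s ≤ 2 * h₂.natDegree := by
  classical
  set h : (ZMod p)[X] := 1 - C β * X ^ s with hh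
  set e : (ZMod p)[X] := 1 - C α * X ^ t with he
  have hs : 0 < s := ht.trans_le hts
  have hsep : h.Separable := separable_binomial hs hsp hβ
  have hh0 : h ≠ 0 := binomial_ne_zero hs β
  have he0 : e ≠ 0 := binomial_ne_zero ht α
  obtain ⟨h₂, hh₂⟩ := EuclideanDomain.gcd_dvd_left h e
  set h₁ := EuclideanDomain.gcd h e with hh₁
  have h1e : h₁ ∣ e := EuclideanDomain.gcd_dvd_right h e
  have hcop : IsCoprime h₁ h₂ := by
    rw [hh₂] at hsep
    exact hsep.isCoprime
  have hcop2 : IsCoprime h₂ e := by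
    rw [← EuclideanDomain.gcd_isUnit_iff]
    refine hcop.isUnit_of_dvd' ?_ (EuclideanDomain.gcd_dvd_left h₂ e)
    exact EuclideanDomain.dvd_gcd ((EuclideanDomain.gcd_dvd_left h₂ e).trans ⟨h₁, by rw [hh₂]; ring⟩)
      (EuclideanDomain.gcd_dvd_right h₂ e)
  have h10 : h₁ ≠ 0 := by rintro h0; rw [h0, zero_mul] at hh₂; exact hh0 hh₂
  have h20 : h₂ ≠ 0 := by rintro h0; rw [h0, mul_zero] at hh₂; exact hh0 hh₂
  have hdeg : h₁.natDegree + h₂.natDegree = s := by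
    rw [← natDegree_mul h10 h20, ← hh₂]
    exact (natDegree_binomial hβ).resolve_right hs.ne'
  refine ⟨h₁, h₂, hh₂, h1e, hcop2, ?_⟩
  have hd1 : h₁.natDegree ≤ t := (natDegree_le_of_dvd h1e he0).trans (natDegree_binomial_le _ _)
  have hdiff : h₁ ∣ C α - C β * X ^ (s - t) := by
    have : C α - C β * X ^ (s - t) = C α * h - C β * X ^ (s - t) * e := by
      have hX : (X : (ZMod p)[X]) ^ s = X ^ (s - t) * X ^ t := by
        rw [← pow_add, Nat.sub_add_cancel hts]
      rw [hh, he, hX]; ring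
    rw [this]
    exact dvd_sub (Dvd.dvd.mul_left ⟨h₂, hh₂⟩ _) (Dvd.dvd.mul_left h1e _)
  have hd2 : h₁.natDegree ≤ s - t := by
    refine (natDegree_le_of_dvd hdiff ?_).trans
      ((natDegree_sub_le _ _).trans (max_le (by simp) (natDegree_C_mul_X_pow_le _ _)))
    rcases hts.eq_or_lt with h0 | h0
    · rw [h0, Nat.sub_self, pow_zero, mul_one, ← C_sub]
      exact C_ne_zero.mpr (sub_ne_zero.mpr (hne h0))
    · intro h3
      have := congrArg (eval 0) h3
      simp [(Nat.sub_pos_of_lt h0).ne'] at this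
      exact hα this
  omega

lemma eq_zero_of_support_subset_of_dvd {K : Type*} [Field K] {h g : K[X]} {B : ℕ}
    (hg : g.support ⊆ Finset.range B) (hB : B ≤ h.natDegree) (hdvd : h ∣ g) : g = 0 := by
  by_contra h0
  have h1 := natDegree_le_of_dvd hdvd h0
  have h2 := Finset.mem_range.mp (hg (natDegree_mem_support_of_nonzero h0))
  omega

lemma card_stepanov_pos {p : ℕ} [Fact p.Prime] {s t M B N : ℕ} {α β c : ZMod p} (hα : α ≠ 0)
    (hβ : β ≠ 0) (ht : 0 < t) (hts : t ≤ s) (hsp : s < p) (hne : t = s → α ≠ β) (hM : 0 < M)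
    (hMs : M * s ≤ p) (hMB : M * (2 * B) ≤ t) (hN : 3 * M < B * N)
    (Z : Finset (ZMod p))
    (hZ : ∀ u ∈ Z, (1 - β * u ^ s) ^ t = c * (1 - α * u ^ t) ^ s ∧
      1 - α * u ^ t ≠ 0 ∧ 1 - β * u ^ s ≠ 0) :
    M * Z.card ≤ M * s + p * (B - 1) + t * s * (N - 1) := by
  classical
  have hs : 0 < s := ht.trans_le hts
  have h2B : 2 * B ≤ t := le_trans (Nat.le_mul_of_pos_left _ hM) hMB
  have hMp : M ≤ p := le_trans (Nat.le_mul_of_pos_right _ hs) hMs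
  obtain ⟨h₁, h₂, hfac, h1e, hcop, hdeg⟩ := exists_factor_binomial hα hβ ht hts hsp hne
  set h : (ZMod p)[X] := 1 - C β * X ^ s with hh
  set e : (ZMod p)[X] := 1 - C α * X ^ t with he
  have hhd : h.natDegree ≤ s := natDegree_binomial_le _ _
  have hed : e.natDegree ≤ t := natDegree_binomial_le _ _
  have hhd' : (derivative h).natDegree ≤ s - 1 := (natDegree_derivative_le _).trans (by omega)
  have hed' : (derivative e).natDegree ≤ t - 1 := (natDegree_derivative_le _).trans (by omega)
  have key := stepanov (f₁ := h ^ t) (f₂ := e ^ s) (r := e * h) (a₁ := (t : (ZMod p)[X]) * (e * derivative h))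
    (a₂ := (s : (ZMod p)[X]) * (h * derivative e)) (ρ := 2 * s) (Δ := t * s) (M := M) (A := M * s) (B := B)
    (N := N) (c := c) ?_ ?_ ?_ ?_ ?_ ?_ ?_ hMp ?_ ?_ Z ?_
  · omega
  · rw [mul_derivative_pow (f := h) (r := e * h) (a := e * derivative h) (by ring)]
  · rw [mul_derivative_pow (f := e) (r := e * h) (a := h * derivative e) (by ring)]
  · exact natDegree_mul_le.trans (by omega)
  · refine natDegree_mul_le.trans ?_
    have := natDegree_mul_le (p := e) (q := derivative h)
    rw [natDegree_natCast]; omega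
  · refine natDegree_mul_le.trans ?_
    have := natDegree_mul_le (p := h) (q := derivative e)
    rw [natDegree_natCast]; omega
  · exact natDegree_pow_le.trans (Nat.mul_le_mul_left _ hhd)
  · refine natDegree_pow_le.trans ?_
    rw [mul_comm t s]; exact Nat.mul_le_mul_left _ hed
  · have h3 : M * (M * s + B + 2 * s * M) = M * (s * (3 * M) + B) := by ring
    have h4 : M * s * B * N = M * (s * (B * N)) := by ring
    rw [h3, h4]
    refine Nat.mul_lt_mul_of_pos_left ?_ hM
    have h5 : s * (3 * M + 1) ≤ s * (B * N) := Nat.mul_le_mul_left _ hN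
    rw [mul_add] at h5
    omega
  · refine linearIndependent_of_dvd (pow_ne_zero _ (binomial_ne_zero hs β)) ?_
    intro n g hg hdvd i hi
    have hQ : h ^ t ∣ ∑ i ∈ Finset.range (M * s), X ^ i * expand (ZMod p) p (g i * e) := by
      have h6 : ∑ i ∈ Finset.range (M * s), X ^ i * expand (ZMod p) p (g i * e) =
          e ^ p * ∑ i ∈ Finset.range (M * s), X ^ i * expand (ZMod p) p (g i) := by
        rw [Finset.mul_sum]
        refine Finset.sum_congr rfl fun i _ => ?_
        rw [map_mul, ZMod.expand_card e]; ring
      rw [h6, hfac, mul_pow]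
      refine mul_dvd_mul ((pow_dvd_pow_of_dvd h1e t).trans (pow_dvd_pow _ (by omega))) ?_
      have h7 : h₂ ^ t ∣ h ^ t := pow_dvd_pow_of_dvd ⟨h₁, by rw [hfac]; ring⟩ t
      refine IsCoprime.dvd_of_dvd_mul_right ?_ (h7.trans hdvd)
      exact (hcop.pow (m := t) (n := s)).pow_right
    have h8 := binomial_dvd_of_pow_dvd_sum_expand hβ hs hsp hMs (fun i => g i * e)
      (Finset.range B ∪ (Finset.range B).map (addRightEmbedding t)) ?_ ?_ hQ i hi
    · refine eq_zero_of_support_subset_of_dvd (h := h₂) (hg i) (by omega) ?_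
      refine hcop.dvd_of_dvd_mul_right (dvd_trans ?_ h8)
      exact ⟨h₁, by rw [← hh, hfac]; ring⟩
    · intro i m hm
      rw [mem_support_iff, he, mul_sub, mul_one, coeff_sub, mul_left_comm, coeff_C_mul,
        coeff_mul_X_pow'] at hm
      by_contra hmE
      simp only [Finset.mem_union, Finset.mem_range, Finset.mem_map, addRightEmbedding_apply,
        not_or, not_exists, not_and] at hmE
      apply hm
      have hc : ∀ m, B ≤ m → (g i).coeff m = 0 := by
        intro m hm
        by_contra h0
        have := Finset.mem_range.mp (hg i (mem_support_iff.mpr h0))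
        omega
      rw [hc m (by omega)]
      split_ifs with h9
      · rw [hc (m - t)]
        · simp
        · by_contra h10
          exact hmE.2 (m - t) (by omega) (by omega)
      · simp
    · refine le_trans (Nat.mul_le_mul_left _ ((Finset.card_union_le _ _).trans ?_)) hMB
      simp; omega
  · intro u hu
    obtain ⟨h1, h2, h3⟩ := hZ u hu
    simp only [he, hh, eval_mul, eval_pow, eval_sub, eval_one, eval_C, eval_X]
    exact ⟨h1, mul_ne_zero h2 h3⟩

lemma card_stepanov_neg {p : ℕ} [Fact p.Prime] {s t M B N : ℕ} {α β c : ZMod p}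
    (hβ : β ≠ 0) (ht : 0 < t) (hts : t ≤ s) (hsp : s < p) (hM : 0 < M)
    (hMs : M * s ≤ p) (hMB : M * (2 * B) ≤ t) (hN : 3 * M < B * N)
    (Z : Finset (ZMod p))
    (hZ : ∀ u ∈ Z, (1 - β * u ^ s) ^ t * (1 - α * u ^ t) ^ s = c * u ^ (s * t) ∧
      1 - α * u ^ t ≠ 0 ∧ 1 - β * u ^ s ≠ 0 ∧ u ≠ 0) :
    M * Z.card ≤ M * s + p * (B - 1) + 2 * (t * s) * (N - 1) := by
  classical
  have hs : 0 < s := ht.trans_le hts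
  have h2B : 2 * B ≤ t := le_trans (Nat.le_mul_of_pos_left _ hM) hMB
  have hMp : M ≤ p := le_trans (Nat.le_mul_of_pos_right _ hs) hMs
  set h : (ZMod p)[X] := 1 - C β * X ^ s with hh
  set e : (ZMod p)[X] := 1 - C α * X ^ t with he
  have hhd : h.natDegree ≤ s := natDegree_binomial_le _ _
  have hed : e.natDegree ≤ t := natDegree_binomial_le _ _
  have hhd' : (derivative h).natDegree ≤ s - 1 := (natDegree_derivative_le _).trans (by omega)
  have hed' : (derivative e).natDegree ≤ t - 1 := (natDegree_derivative_le _).trans (by omega)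
  have key := stepanov (f₁ := h ^ t * e ^ s) (f₂ := X ^ (s * t)) (r := X * e * h)
    (a₁ := (t : (ZMod p)[X]) * (X * (e * derivative h)) + (s : (ZMod p)[X]) * (X * (h * derivative e)))
    (a₂ := ((s * t : ℕ) : (ZMod p)[X]) * (e * h)) (ρ := 2 * s) (Δ := 2 * (t * s)) (M := M)
    (A := M * s) (B := B) (N := N) (c := c) ?_ ?_ ?_ ?_ ?_ ?_ ?_ hMp ?_ ?_ Z ?_
  · omega
  · have h1 := mul_derivative_pow (f := h) (r := X * e * h) (a := X * (e * derivative h)) (by ring) t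
    have h2 := mul_derivative_pow (f := e) (r := X * e * h) (a := X * (h * derivative e)) (by ring) s
    rw [derivative_mul]
    linear_combination e ^ s * h1 + h ^ t * h2
  · have h1 := mul_derivative_pow (f := (X : (ZMod p)[X])) (r := X * e * h) (a := e * h)
      (by rw [derivative_X]; ring) (s * t)
    rw [h1]
  · have h1 := natDegree_mul_le (p := X * e) (q := h)
    have h2 := natDegree_mul_le (p := X) (q := e)
    rw [natDegree_X] at h2
    omega
  · refine natDegree_add_le_of_degree_le ?_ ?_
    · refine natDegree_mul_le.trans ?_
      have h1 := natDegree_mul_le (p := X) (q := e * derivative h)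
      have h2 := natDegree_mul_le (p := e) (q := derivative h)
      rw [natDegree_X] at h1
      rw [natDegree_natCast]; omega
    · refine natDegree_mul_le.trans ?_
      have h1 := natDegree_mul_le (p := X) (q := h * derivative e)
      have h2 := natDegree_mul_le (p := h) (q := derivative e)
      rw [natDegree_X] at h1
      rw [natDegree_natCast]; omega
  · refine natDegree_mul_le.trans ?_
    have := natDegree_mul_le (p := e) (q := h)
    rw [natDegree_natCast]; omega
  · refine natDegree_mul_le.trans ?_
    have h1 : (h ^ t).natDegree ≤ t * s := natDegree_pow_le.trans (Nat.mul_le_mul_left _ hhd)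
    have h2 : (e ^ s).natDegree ≤ t * s := by
      rw [mul_comm t s]; exact natDegree_pow_le.trans (Nat.mul_le_mul_left _ hed)
    omega
  · rw [natDegree_X_pow, mul_comm s t]; omega
  · have h3 : M * (M * s + B + 2 * s * M) = M * (s * (3 * M) + B) := by ring
    have h4 : M * s * B * N = M * (s * (B * N)) := by ring
    rw [h3, h4]
    refine Nat.mul_lt_mul_of_pos_left ?_ hM
    have h5 : s * (3 * M + 1) ≤ s * (B * N) := Nat.mul_le_mul_left _ hN
    rw [mul_add] at h5
    omega
  · refine linearIndependent_of_dvd (mul_ne_zero (pow_ne_zero _ (binomial_ne_zero hs β))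
      (pow_ne_zero _ (binomial_ne_zero ht α))) ?_
    intro n g hg hdvd i hi
    have hQ : h ^ t ∣ ∑ i ∈ Finset.range (M * s), X ^ i * expand (ZMod p) p (g i) := by
      refine IsCoprime.dvd_of_dvd_mul_right ?_ ((dvd_mul_right _ _).trans hdvd)
      exact ((isCoprime_binomial_X hs β).pow (m := t) (n := s * t)).pow_right
    have h8 := binomial_dvd_of_pow_dvd_sum_expand hβ hs hsp hMs g
      (Finset.range B) hg ?_ hQ i hi
    · refine eq_zero_of_support_subset_of_dvd (hg i) ?_ h8
      rw [(natDegree_binomial hβ).resolve_right hs.ne']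
      omega
    · refine le_trans (Nat.mul_le_mul_left _ ?_) hMB
      simp; omega
  · intro u hu
    obtain ⟨h1, h2, h3, h4⟩ := hZ u hu
    simp only [he, hh, eval_mul, eval_pow, eval_sub, eval_one, eval_C, eval_X]
    exact ⟨h1, mul_ne_zero (mul_ne_zero h4 h2) h3⟩

/-- Choice of the parameters in Stepanov's method. -/
lemma exists_stepanov_parameters {p s t : ℕ} {x : ℝ} (hx : 4 ≤ x) (hxp : x ^ 12 = p) (ht : 2 ≤ t)
    (hp : t * s ≤ p) (hs : (s : ℝ) ≤ 2 * x ^ 6) :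
    ∃ M B N : ℕ, 0 < M ∧ M * s ≤ p ∧ M * (2 * B) ≤ t ∧ 3 * M < B * N ∧
      ∀ z : ℕ, M * z ≤ M * s + p * (B - 1) + 2 * (t * s) * (N - 1) → (z : ℝ) ≤ 19 * x ^ 10 := by
  have hx0 : 0 < x := by linarith
  have htR : (2 : ℝ) ≤ t := by exact_mod_cast ht
  set b : ℕ := ⌊√(t : ℝ) / x⌋₊ with hb
  have hb1 : (b : ℝ) * x ≤ √(t : ℝ) := by
    rw [← le_div_iff₀ hx0]; exact Nat.floor_le (by positivity)
  have hb2 : √(t : ℝ) < ((b : ℝ) + 1) * x := by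
    rw [← div_lt_iff₀ hx0]; exact Nat.lt_floor_add_one _
  have hsq : √(t : ℝ) ^ 2 = t := Real.sq_sqrt (by positivity)
  have hb3 : ((b : ℝ) * x) ^ 2 ≤ t := by
    rw [← hsq]; exact pow_le_pow_left₀ (by positivity) hb1 2
  have hb4 : (t : ℝ) ≤ (((b : ℝ) + 1) * x) ^ 2 := by
    rw [← hsq]; exact pow_le_pow_left₀ (by positivity) hb2.le 2
  have h2B : 2 * (b + 1) ≤ t := by
    rcases Nat.eq_zero_or_pos b with h0 | h0
    · rw [h0]; omega
    · have hbR : (1 : ℝ) ≤ b := by exact_mod_cast h0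
      have : ((2 * (b + 1) : ℕ) : ℝ) ≤ t := by
        push_cast
        nlinarith [mul_self_nonneg (x - 4), mul_self_nonneg ((b : ℝ) - 1),
          mul_le_mul hbR hx (by norm_num) (by positivity)]
      exact_mod_cast this
  set M := t / (2 * (b + 1)) with hM
  have hM0 : 0 < M := Nat.div_pos h2B (by omega)
  have hMt : M * (2 * (b + 1)) ≤ t := Nat.div_mul_le_self _ _
  have hMt' : t < (M + 1) * (2 * (b + 1)) := by
    rw [mul_comm]; exact Nat.lt_mul_div_succ _ (by omega)
  have hMs : M * s ≤ p := (Nat.mul_le_mul_right _ (Nat.div_le_self _ _)).trans hp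
  refine ⟨M, b + 1, 3 * M / (b + 1) + 1, hM0, hMs, hMt, Nat.lt_mul_div_succ _ (by omega), ?_⟩
  intro z hz
  rw [Nat.add_sub_cancel, Nat.add_sub_cancel] at hz
  have hzR : (M : ℝ) * z ≤ M * s + p * b + 2 * (t * s) * ((3 * M / (b + 1) : ℕ) : ℝ) := by
    exact_mod_cast hz
  have hN : ((3 * M / (b + 1) : ℕ) : ℝ) ≤ 3 * M / ((b : ℝ) + 1) := by
    have := @Nat.cast_div_le ℝ _ _ _ (3 * M) (b + 1)
    push_cast at this
    exact this
  have hMR : (0 : ℝ) < M := by exact_mod_cast hM0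
  have hM1 : (1 : ℝ) ≤ M := by exact_mod_cast hM0
  have hMtR : (t : ℝ) ≤ M * (4 * ((b : ℝ) + 1)) := by
    have : (t : ℝ) ≤ (M + 1) * (2 * ((b : ℝ) + 1)) := by exact_mod_cast hMt'.le
    nlinarith [(Nat.cast_nonneg b : (0 : ℝ) ≤ b)]
  have h1 : (p : ℝ) * b ≤ M * (8 * x ^ 10) := by
    have h2 : (b : ℝ) * (b + 1) * x ^ 2 ≤ 2 * t := by
      rcases Nat.eq_zero_or_pos b with h0 | h0
      · rw [h0]; simp
      · have hbR : (1 : ℝ) ≤ b := by exact_mod_cast h0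
        have : (b : ℝ) * (b + 1) ≤ 2 * b ^ 2 := by nlinarith
        calc (b : ℝ) * (b + 1) * x ^ 2 ≤ 2 * b ^ 2 * x ^ 2 := by gcongr
          _ = 2 * (b * x) ^ 2 := by ring
          _ ≤ 2 * t := by linarith
    have h3 : (t : ℝ) * (p * b) ≤ t * (M * (8 * x ^ 10)) := by
      calc (t : ℝ) * (p * b) ≤ M * (4 * ((b : ℝ) + 1)) * (p * b) := by gcongr
        _ = M * (4 * x ^ 10) * (b * (b + 1) * x ^ 2) := by rw [← hxp]; ring
        _ ≤ M * (4 * x ^ 10) * (2 * t) := by gcongr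
        _ = t * (M * (8 * x ^ 10)) := by ring
    exact le_of_mul_le_mul_left h3 (by linarith)
  have h2 : 6 * ((t : ℝ) * s) / (b + 1) ≤ 9 * x ^ 10 := by
    refine abs_le_of_sq_le_sq' ?_ (by positivity) |>.2
    rw [div_pow, div_le_iff₀ (by positivity)]
    have hpR : (t : ℝ) * s ≤ x ^ 12 := by rw [hxp]; exact_mod_cast hp
    calc (6 * ((t : ℝ) * s)) ^ 2 = 36 * (t * s) * s * t := by ring
      _ ≤ 36 * x ^ 12 * (2 * x ^ 6) * (((b : ℝ) + 1) * x) ^ 2 := by gcongr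
      _ = 72 * x ^ 20 * ((b : ℝ) + 1) ^ 2 := by ring
      _ ≤ 81 * x ^ 20 * ((b : ℝ) + 1) ^ 2 := by gcongr; norm_num
      _ = (9 * x ^ 10) ^ 2 * ((b : ℝ) + 1) ^ 2 := by ring
  have h3 : 2 * ((t : ℝ) * s) * ((3 * M / (b + 1) : ℕ) : ℝ) ≤ M * (9 * x ^ 10) := by
    calc 2 * ((t : ℝ) * s) * ((3 * M / (b + 1) : ℕ) : ℝ)
        ≤ 2 * ((t : ℝ) * s) * (3 * M / ((b : ℝ) + 1)) := by gcongr
      _ = M * (6 * ((t : ℝ) * s) / (b + 1)) := by ring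
      _ ≤ M * (9 * x ^ 10) := by gcongr
  have h4 : x ^ 6 ≤ x ^ 10 := pow_le_pow_right₀ (by linarith) (by norm_num)
  have h5 : (M : ℝ) * z ≤ M * (19 * x ^ 10) := by
    have : (M : ℝ) * s ≤ M * (2 * x ^ 10) := by gcongr; linarith
    linarith
  exact le_of_mul_le_mul_left h5 hMR

lemma card_le_of_binomial_eq {p : ℕ} [Fact p.Prime] {s t : ℕ} {x : ℝ} (hx : 4 ≤ x)
    (hxp : x ^ 12 = p) (ht : 2 ≤ t) (hs : 2 ≤ s) (hp : t * s ≤ p) (htx : (t : ℝ) ≤ 2 * x ^ 6)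
    (hsx : (s : ℝ) ≤ 2 * x ^ 6) {α β c : ZMod p} (hα : α ≠ 0) (hβ : β ≠ 0) (hc : c ≠ 0)
    (hne : t = s → α ≠ β) (Z : Finset (ZMod p))
    (hZ : ∀ u ∈ Z, (1 - β * u ^ s) ^ t = c * (1 - α * u ^ t) ^ s ∧
      1 - α * u ^ t ≠ 0 ∧ 1 - β * u ^ s ≠ 0) : (Z.card : ℝ) ≤ 19 * x ^ 10 := by
  have hlt : 2 * x ^ 6 < p := by
    rw [← hxp]
    have : (4 : ℝ) ^ 6 ≤ x ^ 6 := pow_le_pow_left₀ (by norm_num) hx 6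
    nlinarith
  rcases le_total t s with hts | hts
  · obtain ⟨M, B, N, hM, hMs, hMB, hN, hz⟩ := exists_stepanov_parameters hx hxp ht hp hsx
    refine hz _ ((card_stepanov_pos hα hβ (by omega) hts ?_ hne hM hMs hMB hN Z hZ).trans ?_)
    · exact_mod_cast hsx.trans_lt hlt
    · exact Nat.add_le_add_left (Nat.mul_le_mul_right _ (by omega)) _
  · obtain ⟨M, B, N, hM, hMs, hMB, hN, hz⟩ := exists_stepanov_parameters hx hxp hs
      (by rwa [mul_comm]) htx
    refine hz _ ((card_stepanov_pos (c := c⁻¹) hβ hα (by omega) hts ?_ (fun h => (hne h.symm).symm)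
      hM hMs hMB hN Z ?_).trans ?_)
    · exact_mod_cast htx.trans_lt hlt
    · intro u hu
      obtain ⟨h1, h2, h3⟩ := hZ u hu
      refine ⟨?_, h3, h2⟩
      rw [h1, inv_mul_cancel_left₀ hc]
    · exact Nat.add_le_add_left (Nat.mul_le_mul_right _ (by omega)) _

lemma card_le_of_binomial_mul_eq {p : ℕ} [Fact p.Prime] {s t : ℕ} {x : ℝ} (hx : 4 ≤ x)
    (hxp : x ^ 12 = p) (ht : 2 ≤ t) (hs : 2 ≤ s) (hp : t * s ≤ p) (htx : (t : ℝ) ≤ 2 * x ^ 6)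
    (hsx : (s : ℝ) ≤ 2 * x ^ 6) {α β c : ZMod p} (hα : α ≠ 0) (hβ : β ≠ 0)
    (Z : Finset (ZMod p))
    (hZ : ∀ u ∈ Z, (1 - β * u ^ s) ^ t * (1 - α * u ^ t) ^ s = c * u ^ (s * t) ∧
      1 - α * u ^ t ≠ 0 ∧ 1 - β * u ^ s ≠ 0 ∧ u ≠ 0) : (Z.card : ℝ) ≤ 19 * x ^ 10 := by
  have hlt : 2 * x ^ 6 < p := by
    rw [← hxp]
    have : (4 : ℝ) ^ 6 ≤ x ^ 6 := pow_le_pow_left₀ (by norm_num) hx 6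
    nlinarith
  rcases le_total t s with hts | hts
  · obtain ⟨M, B, N, hM, hMs, hMB, hN, hz⟩ := exists_stepanov_parameters hx hxp ht hp hsx
    refine hz _ (card_stepanov_neg hβ (by omega) hts ?_ hM hMs hMB hN Z hZ)
    exact_mod_cast hsx.trans_lt hlt
  · obtain ⟨M, B, N, hM, hMs, hMB, hN, hz⟩ := exists_stepanov_parameters hx hxp hs
      (by rwa [mul_comm]) htx
    refine hz _ (card_stepanov_neg (c := c) (α := β) hα (by omega) hts ?_ hM hMs hMB hN Z ?_)
    · exact_mod_cast htx.trans_lt hlt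
    · intro u hu
      obtain ⟨h1, h2, h3, h4⟩ := hZ u hu
      exact ⟨by rw [mul_comm, h1, mul_comm s t], h3, h2, h4⟩

/-- Dirichlet approximation of `k / (p - 1)`, avoiding trivial exponents. -/
lemma exists_small_exponents {p k : ℕ} (hp : 100 ≤ p) (hk : Nat.gcd k (p - 1) = 1) :
    ∃ (t : ℕ) (s : ℤ), 2 ≤ t ∧ 2 ≤ s.natAbs ∧ t * s.natAbs ≤ p ∧ t ^ 2 ≤ 4 * p ∧
      s.natAbs ^ 2 ≤ 4 * p ∧ ((p : ℤ) - 1) ∣ s - k * t := by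
  set r := Nat.sqrt p with hr
  have hr1 : r * r ≤ p := Nat.sqrt_le p
  have hr2 : p < (r + 1) * (r + 1) := Nat.lt_succ_sqrt p
  have hr9 : 9 < r := by by_contra h; have : r ≤ 9 := by omega
                         nlinarith
  have hr0 : 0 < r := by omega
  obtain ⟨j, q, hq0, hqr, hq⟩ := Real.exists_int_int_abs_mul_sub_le ((k : ℝ) / ((p : ℝ) - 1)) hr0
  have hp1 : (0 : ℝ) < (p : ℝ) - 1 := by
    have : (100 : ℝ) ≤ p := by exact_mod_cast hp
    linarith
  set s : ℤ := q * k - j * (p - 1) with hs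
  have hsabs : |s| * (r + 1) ≤ (p : ℤ) - 1 := by
    have h1 : (|s| : ℝ) * (r + 1) ≤ (p : ℝ) - 1 := by
      have h2 : (s : ℝ) = ((q : ℝ) * (k / ((p : ℝ) - 1)) - j) * ((p : ℝ) - 1) := by
        rw [hs]; push_cast; field_simp
      rw [h2, abs_mul, abs_of_pos hp1]
      rw [le_div_iff₀ (by positivity)] at hq
      nlinarith
    exact_mod_cast h1
  obtain ⟨t, rfl⟩ : ∃ t : ℕ, q = t := ⟨q.toNat, by omega⟩
  have htr : t ≤ r := by exact_mod_cast hqr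
  have ht0 : 0 < t := by exact_mod_cast hq0
  have hdvd : ((p : ℤ) - 1) ∣ s - k * t := ⟨-j, by rw [hs]; ring⟩
  have hs0 : s ≠ 0 := by
    intro h0
    rw [h0, zero_sub, dvd_neg] at hdvd
    have h1 : (p - 1) ∣ k * t := by
      have : ((p - 1 : ℕ) : ℤ) ∣ ((k * t : ℕ) : ℤ) := by
        rw [Nat.cast_sub (by omega)]; push_cast; exact hdvd
      exact_mod_cast this
    have h2 : (p - 1) ∣ t := (Nat.Coprime.symm hk).dvd_of_dvd_mul_left h1
    have := Nat.le_of_dvd ht0 h2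
    have : 10 * r ≤ r * r := Nat.mul_le_mul_right _ hr9
    omega
  set σ := s.natAbs with hσ
  have hσ0 : 0 < σ := Int.natAbs_pos.mpr hs0
  have hσr : σ * (r + 1) ≤ p - 1 := by
    have : ((σ * (r + 1) : ℕ) : ℤ) ≤ ((p - 1 : ℕ) : ℤ) := by
      rw [Nat.cast_sub (by omega)]; push_cast
      rw [hσ, Int.natCast_natAbs]; exact hsabs
    exact_mod_cast this
  have hσr' : σ ≤ r := by
    by_contra h
    have : (r + 1) * (r + 1) ≤ σ * (r + 1) := Nat.mul_le_mul_right _ (by omega)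
    omega
  have h4r : 10 * r ≤ r * r := Nat.mul_le_mul_right _ hr9
  have hsqσ : σ * σ ≤ r * r := Nat.mul_le_mul hσr' hσr'
  have hsqt : t * t ≤ r * r := Nat.mul_le_mul htr htr
  by_cases hmin : 2 ≤ t ∧ 2 ≤ σ
  · refine ⟨t, s, hmin.1, hmin.2, ?_, ?_, ?_, hdvd⟩
    · exact (Nat.mul_le_mul htr hσr').trans hr1
    · rw [sq]; omega
    · change σ ^ 2 ≤ 4 * p; rw [sq]; omega
  · refine ⟨2 * t, 2 * s, by omega, ?_, ?_, ?_, ?_, ?_⟩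
    · rw [Int.natAbs_mul]; change 2 ≤ 2 * σ; omega
    · rw [Int.natAbs_mul]; change 2 * t * (2 * σ) ≤ p
      have h5 : t = 1 ∨ σ = 1 := by omega
      rcases h5 with h5 | h5 <;> rw [h5] <;> omega
    · nlinarith
    · rw [Int.natAbs_mul]; change (2 * σ) ^ 2 ≤ 4 * p; nlinarith
    · push_cast
      have : 2 * s - (k : ℤ) * (2 * t) = 2 * (s - k * t) := by ring
      rw [this]; exact Dvd.dvd.mul_left hdvd _

end

lemma zpow_eq_pow_of_dvd {p k t : ℕ} [Fact p.Prime] {s : ℤ} (hdvd : ((p : ℤ) - 1) ∣ s - k * t)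
    {z : ZMod p} (hz : z ≠ 0) : z ^ s = (z ^ k) ^ t := by
  obtain ⟨j, hj⟩ := hdvd
  have hp := (Fact.out : p.Prime).one_lt
  have h1 : s = ((k * t : ℕ) : ℤ) + ((p - 1 : ℕ) : ℤ) * j := by
    rw [Nat.cast_sub hp.le]; push_cast; linarith
  rw [h1, zpow_add₀ hz, zpow_mul, zpow_natCast, zpow_natCast, ZMod.pow_card_sub_one_eq_one hz,
    one_zpow, mul_one, pow_mul]

/-- The solutions of `(z + 1) ^ k - z ^ k = c` which are not in the degenerate coset. -/
def powDiffSolutions (p k : ℕ) [NeZero p] (c : ZMod p) : Finset (ZMod p) :=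
  Finset.univ.filter fun z => z ≠ 0 ∧ z + 1 ≠ 0 ∧ (z + 1) ^ k = z ^ k + c ∧ z ^ (k - 1) ≠ c

lemma card_preimage_powDiffSolutions {p k t : ℕ} [Fact p.Prime] {s : ℤ} {x : ℝ} (hx : 4 ≤ x)
    (hxp : x ^ 12 = p) (hk : 1 ≤ k) (ht : 2 ≤ t) (hs : 2 ≤ s.natAbs) (hp : t * s.natAbs ≤ p)
    (htx : (t : ℝ) ≤ 2 * x ^ 6) (hsx : (s.natAbs : ℝ) ≤ 2 * x ^ 6)
    (hdvd : ((p : ℤ) - 1) ∣ s - k * t) {c α : ZMod p} (hc : c ≠ 0) (hα : α ≠ 0) :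
    (((Finset.univ.filter fun u : ZMod p => u ≠ 0 ∧ α * u ^ t ∈ powDiffSolutions p k c).card : ℕ)
      : ℝ) ≤ 19 * x ^ 10 := by
  set Z := Finset.univ.filter fun u : ZMod p => u ≠ 0 ∧ α * u ^ t ∈ powDiffSolutions p k c with hZ
  have hmem : ∀ u ∈ Z, u ≠ 0 ∧ 1 + α * u ^ t ≠ 0 ∧ c + α ^ k * u ^ s ≠ 0 ∧
      (c + α ^ k * u ^ s) ^ t = (1 + α * u ^ t) ^ s ∧ (α * u ^ t) ^ (k - 1) ≠ c := by
    intro u hu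
    simp only [hZ, powDiffSolutions, Finset.mem_filter, Finset.mem_univ, true_and] at hu
    obtain ⟨h0, h1, h2, h3, h4⟩ := hu
    have h5 : (α * u ^ t) ^ k = α ^ k * u ^ s := by
      rw [zpow_eq_pow_of_dvd hdvd h0, mul_pow, ← pow_mul, ← pow_mul, mul_comm t k]
    have h6 : c + α ^ k * u ^ s = (α * u ^ t + 1) ^ k := by rw [h3, h5, add_comm]
    refine ⟨h0, by rwa [add_comm], ?_, ?_, h4⟩
    · rw [h6]; exact pow_ne_zero _ h2
    · rw [h6, add_comm 1, zpow_eq_pow_of_dvd hdvd h2]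
  rcases Z.eq_empty_or_nonempty with hemp | ⟨u₀, hu₀⟩
  · rw [hemp]; simp; positivity
  have hαk : α ^ k ≠ 0 := pow_ne_zero _ hα
  rcases le_total 0 s with hs0 | hs0
  · obtain ⟨σ, rfl⟩ := Int.eq_ofNat_of_zero_le hs0
    rw [Int.natAbs_natCast] at *
    refine card_le_of_binomial_eq hx hxp ht hs hp htx hsx (α := -α) (β := -(α ^ k) / c)
      (c := (c ^ t)⁻¹) (neg_ne_zero.mpr hα) (div_ne_zero (neg_ne_zero.mpr hαk) hc)
      (inv_ne_zero (pow_ne_zero _ hc)) ?_ Z ?_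
    · rintro rfl h
      obtain ⟨h0, -, -, -, h4⟩ := hmem u₀ hu₀
      apply h4
      have h5 : α ^ (k - 1) = c := by
        rw [eq_div_iff hc] at h
        have h6 : α * α ^ (k - 1) = α * c := by
          rw [← pow_succ', Nat.sub_add_cancel hk]; linear_combination h
        exact mul_left_cancel₀ hα h6
      have h7 := zpow_eq_pow_of_dvd hdvd h0
      rw [zpow_natCast] at h7
      have h8 : (u₀ ^ t) ^ (k - 1) = 1 := by
        have h9 : u₀ ^ t * (u₀ ^ t) ^ (k - 1) = u₀ ^ t * 1 := by
          rw [← pow_succ', Nat.sub_add_cancel hk, mul_one, ← pow_mul, mul_comm t k, pow_mul, ← h7]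
        exact mul_left_cancel₀ (pow_ne_zero _ h0) h9
      rw [mul_pow, h8, h5, mul_one]
    · intro u hu
      obtain ⟨h0, h1, h2, h3, -⟩ := hmem u hu
      rw [zpow_natCast] at h2
      rw [zpow_natCast, zpow_natCast] at h3
      have h4 : 1 - -(α ^ k) / c * u ^ σ = (c + α ^ k * u ^ σ) / c := by field_simp; ring
      have h5 : 1 - -α * u ^ t = 1 + α * u ^ t := by ring
      rw [h4, h5]
      refine ⟨?_, h1, div_ne_zero h2 hc⟩
      rw [div_pow, h3, div_eq_mul_inv, mul_comm]
  · obtain ⟨σ, hσ⟩ := Int.eq_ofNat_of_zero_le (neg_nonneg.mpr hs0)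
    obtain rfl : s = -(σ : ℤ) := by omega
    rw [Int.natAbs_neg, Int.natAbs_natCast] at *
    refine card_le_of_binomial_mul_eq hx hxp ht hs hp htx hsx (α := -α) (β := -c / (α ^ k))
      (c := ((α ^ k) ^ t)⁻¹) (neg_ne_zero.mpr hα) (div_ne_zero (neg_ne_zero.mpr hc) hαk) Z ?_
    intro u hu
    obtain ⟨h0, h1, h2, h3, -⟩ := hmem u hu
    rw [zpow_neg, zpow_natCast] at h2
    rw [zpow_neg, zpow_natCast, zpow_neg, zpow_natCast] at h3
    have hus : u ^ σ ≠ 0 := pow_ne_zero _ h0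
    have h4 : 1 - -c / (α ^ k) * u ^ σ = (c + α ^ k * (u ^ σ)⁻¹) * (u ^ σ) * (α ^ k)⁻¹ := by
      field_simp; ring
    have h5 : 1 - -α * u ^ t = 1 + α * u ^ t := by ring
    rw [h4, h5]
    refine ⟨?_, h1, mul_ne_zero (mul_ne_zero h2 hus) (inv_ne_zero hαk), h0⟩
    rw [mul_pow, mul_pow, h3, pow_mul, inv_pow]
    have := pow_ne_zero σ h1
    field_simp

lemma card_powDiffSolutions_le {p k : ℕ} [Fact p.Prime] {x : ℝ} (hx : 4 ≤ x) (hxp : x ^ 12 = p)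
    (hk : 1 ≤ k) (hkp : Nat.gcd k (p - 1) = 1) {c : ZMod p} (hc : c ≠ 0) :
    ((powDiffSolutions p k c).card : ℝ) ≤ 19 * x ^ 10 := by
  classical
  have hp1 := (Fact.out : p.Prime).one_lt
  have hx6 : (0 : ℝ) ≤ 2 * x ^ 6 := by positivity
  have hp100 : 100 ≤ p := by
    have : (100 : ℝ) ≤ p := by
      rw [← hxp]
      exact le_trans (by norm_num) (pow_le_pow_left₀ (by norm_num) hx 12)
    exact_mod_cast this
  obtain ⟨t, s, ht, hs, hts, ht2, hs2, hdvd⟩ := exists_small_exponents hp100 hkp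
  have htx : (t : ℝ) ≤ 2 * x ^ 6 := by
    refine abs_le_of_sq_le_sq' ?_ hx6 |>.2
    have : ((t : ℝ)) ^ 2 ≤ 4 * p := by exact_mod_cast ht2
    rw [← hxp] at this; linarith
  have hsx : (s.natAbs : ℝ) ≤ 2 * x ^ 6 := by
    refine abs_le_of_sq_le_sq' ?_ hx6 |>.2
    have : ((s.natAbs : ℕ) : ℝ) ^ 2 ≤ 4 * p := by exact_mod_cast hs2
    rw [← hxp] at this; linarith
  set X := powDiffSolutions p k c with hX
  set U : Finset (ZMod p) := Finset.univ.filter fun u => u ≠ 0 with hU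
  have hUcard : U.card = p - 1 := by
    have : U = Finset.univ.erase 0 := by ext u; simp [hU]
    rw [this, Finset.card_erase_of_mem (Finset.mem_univ _), Finset.card_univ, ZMod.card]
  have hcount : ∑ α ∈ U, (Finset.univ.filter fun u : ZMod p => u ≠ 0 ∧ α * u ^ t ∈ X).card
      = U.card * X.card := by
    have h1 : ∀ α, (Finset.univ.filter fun u : ZMod p => u ≠ 0 ∧ α * u ^ t ∈ X).card
        = ∑ u ∈ U, if α * u ^ t ∈ X then 1 else 0 := by
      intro α
      rw [← Finset.card_filter, hU, Finset.filter_filter]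
    simp only [h1]
    rw [Finset.sum_comm, ← smul_eq_mul, ← Finset.sum_const]
    refine Finset.sum_congr rfl fun u hu => ?_
    have hu0 : u ^ t ≠ 0 := pow_ne_zero _ (Finset.mem_filter.mp hu).2
    rw [← Finset.card_filter]
    refine Finset.card_bij (fun α _ => α * u ^ t) ?_ ?_ ?_
    · intro α hα; exact (Finset.mem_filter.mp hα).2
    · intro α _ β _ h; exact mul_right_cancel₀ hu0 h
    · intro z hz
      have hz0 : z ≠ 0 := by
        rw [hX, powDiffSolutions, Finset.mem_filter] at hz
        exact hz.2.1
      refine ⟨z / u ^ t, ?_, div_mul_cancel₀ _ hu0⟩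
      simp only [hU, Finset.mem_filter, Finset.mem_univ, true_and]
      exact ⟨div_ne_zero hz0 hu0, by rwa [div_mul_cancel₀ _ hu0]⟩
  have hle : (U.card : ℝ) * X.card ≤ U.card * (19 * x ^ 10) := by
    have h2 : (U.card : ℝ) * X.card
        = ∑ α ∈ U, ((Finset.univ.filter fun u : ZMod p => u ≠ 0 ∧ α * u ^ t ∈ X).card : ℝ) := by
      exact_mod_cast hcount.symm
    rw [h2, ← nsmul_eq_mul]
    refine Finset.sum_le_card_nsmul _ _ _ fun α hα => ?_
    exact card_preimage_powDiffSolutions hx hxp hk ht hs hts htx hsx hdvd hc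
      (Finset.mem_filter.mp hα).2
  refine le_of_mul_le_mul_left hle ?_
  rw [hUcard]
  exact_mod_cast (by omega : 0 < p - 1)

section

open ZMod

lemma ofReal_norm_sq_sum_char {p : ℕ} [Fact p.Prime] {ι : Type*} (I : Finset ι) (φ : ι → ZMod p) :
    ((‖∑ i ∈ I, stdAddChar (φ i)‖ ^ 2 : ℝ) : ℂ)
      = ∑ i ∈ I, ∑ j ∈ I, stdAddChar (φ i - φ j) := by
  push_cast
  rw [← Complex.mul_conj', map_sum, Finset.sum_mul_sum]
  refine Finset.sum_congr rfl fun i _ => Finset.sum_congr rfl fun j _ => ?_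
  rw [← AddChar.map_neg_eq_conj, sub_eq_add_neg, AddChar.map_add_eq_mul]

lemma sum_stdAddChar_mul {p : ℕ} [Fact p.Prime] (m : ZMod p) :
    ∑ a : ZMod p, stdAddChar (a * m) = if m = 0 then (p : ℂ) else 0 := by
  have := AddChar.sum_mulShift m (isPrimitive_stdAddChar p)
  rw [this, ZMod.card]
  push_cast
  rfl

/-- Parseval's identity on `ZMod p`. -/
lemma sum_norm_sq_sum_char {p : ℕ} [Fact p.Prime] {ι : Type*} (I : Finset ι) (φ : ι → ZMod p) :
    ∑ a : ZMod p, ‖∑ i ∈ I, stdAddChar (a * φ i)‖ ^ 2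
      = p * ∑ i ∈ I, (((I.filter fun j => φ j = φ i).card : ℕ) : ℝ) := by
  classical
  have : ((∑ a : ZMod p, ‖∑ i ∈ I, stdAddChar (a * φ i)‖ ^ 2 : ℝ) : ℂ)
      = ((p * ∑ i ∈ I, (((I.filter fun j => φ j = φ i).card : ℕ) : ℝ) : ℝ) : ℂ) := by
    rw [Complex.ofReal_sum]
    simp only [ofReal_norm_sq_sum_char, ← mul_sub]
    rw [Finset.sum_comm]
    push_cast
    rw [Finset.mul_sum]
    refine Finset.sum_congr rfl fun i _ => ?_
    rw [Finset.sum_comm]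
    simp only [sum_stdAddChar_mul, sub_eq_zero]
    rw [Finset.card_filter]
    push_cast
    rw [Finset.mul_sum]
    refine Finset.sum_congr rfl fun j _ => ?_
    by_cases h : φ i = φ j
    · simp [h]
    · simp [h, Ne.symm h]
  exact_mod_cast this

/-- Parseval's identity on `ZMod p × ZMod p`. -/
lemma sum_sum_norm_sq_sum_char {p : ℕ} [Fact p.Prime] {ι : Type*} (I : Finset ι)
    (φ₁ φ₂ : ι → ZMod p) :
    ∑ a : ZMod p, ∑ b : ZMod p, ‖∑ i ∈ I, stdAddChar (a * φ₁ i + b * φ₂ i)‖ ^ 2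
      = p ^ 2 * ∑ i ∈ I, (((I.filter fun j => φ₁ j = φ₁ i ∧ φ₂ j = φ₂ i).card : ℕ) : ℝ) := by
  classical
  have : ((∑ a : ZMod p, ∑ b : ZMod p, ‖∑ i ∈ I, stdAddChar (a * φ₁ i + b * φ₂ i)‖ ^ 2 : ℝ) : ℂ)
      = ((p ^ 2 * ∑ i ∈ I, (((I.filter fun j => φ₁ j = φ₁ i ∧ φ₂ j = φ₂ i).card : ℕ) : ℝ) : ℝ)
        : ℂ) := by
    simp only [Complex.ofReal_sum, ofReal_norm_sq_sum_char]
    have h1 : ∀ (a b : ZMod p) (i j : ι), stdAddChar (a * φ₁ i + b * φ₂ i - (a * φ₁ j + b * φ₂ j))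
        = stdAddChar (a * (φ₁ i - φ₁ j)) * stdAddChar (b * (φ₂ i - φ₂ j)) := by
      intro a b i j
      rw [← AddChar.map_add_eq_mul]; congr 1; ring
    simp only [h1]
    push_cast
    have h2 : ∀ a : ZMod p, ∑ b : ZMod p, ∑ i ∈ I, ∑ j ∈ I,
        stdAddChar (a * (φ₁ i - φ₁ j)) * stdAddChar (b * (φ₂ i - φ₂ j))
        = ∑ i ∈ I, ∑ j ∈ I, stdAddChar (a * (φ₁ i - φ₁ j)) *
          (if φ₂ i - φ₂ j = 0 then (p : ℂ) else 0) := by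
      intro a
      rw [Finset.sum_comm]
      refine Finset.sum_congr rfl fun i _ => ?_
      rw [Finset.sum_comm]
      refine Finset.sum_congr rfl fun j _ => ?_
      rw [← Finset.mul_sum, sum_stdAddChar_mul]
    simp only [h2]
    rw [Finset.sum_comm, Finset.mul_sum]
    refine Finset.sum_congr rfl fun i _ => ?_
    rw [Finset.sum_comm, Finset.card_filter]
    push_cast
    rw [Finset.mul_sum]
    refine Finset.sum_congr rfl fun j _ => ?_
    rw [← Finset.sum_mul, sum_stdAddChar_mul]
    simp only [sub_eq_zero]
    by_cases ha : φ₁ i = φ₁ j <;> by_cases hb : φ₂ i = φ₂ j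
    · simp [ha, hb, sq]
    · simp [hb, Ne.symm hb]
    · simp [ha, Ne.symm ha]
    · simp [ha, Ne.symm ha]
  exact_mod_cast this

lemma card_filter_ne_zero (p : ℕ) [Fact p.Prime] :
    (Finset.univ.filter fun x : ZMod p => x ≠ 0).card = p - 1 := by
  classical
  have : (Finset.univ.filter fun x : ZMod p => x ≠ 0) = Finset.univ.erase 0 := by ext u; simp
  rw [this, Finset.card_erase_of_mem (Finset.mem_univ _), Finset.card_univ, ZMod.card]

lemma card_filter_pow_eq_one {p : ℕ} [Fact p.Prime] (m : ℕ) :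
    (Finset.univ.filter fun x : ZMod p => x ≠ 0 ∧ x ^ m = 1).card = Nat.gcd m (p - 1) := by
  classical
  have h := IsCyclic.card_powMonoidHom_ker (G := (ZMod p)ˣ) m
  rw [Nat.card_eq_fintype_card (α := (ZMod p)ˣ), ZMod.card_units, Nat.gcd_comm,
    Nat.card_eq_fintype_card, ← Finset.card_univ] at h
  rw [← h]
  symm
  refine Finset.card_bij (fun u _ => ((u : (ZMod p)ˣ) : ZMod p)) ?_ ?_ ?_
  · rintro ⟨u, hu⟩ _
    rw [MonoidHom.mem_ker, powMonoidHom_apply] at hu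
    simp only [Finset.mem_filter, Finset.mem_univ, true_and]
    exact ⟨u.ne_zero, by rw [← Units.val_pow_eq_pow_val, hu, Units.val_one]⟩
  · rintro u _ v _ huv
    exact Subtype.ext (Units.ext huv)
  · intro x hx
    obtain ⟨hx0, hx1⟩ := (Finset.mem_filter.mp hx).2
    refine ⟨⟨Units.mk0 x hx0, ?_⟩, Finset.mem_univ _, rfl⟩
    rw [MonoidHom.mem_ker, powMonoidHom_apply]
    exact Units.ext (by simpa using hx1)

lemma card_filter_pow_eq_le {p : ℕ} [Fact p.Prime] (m : ℕ) (c : ZMod p) :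
    (Finset.univ.filter fun x : ZMod p => x ≠ 0 ∧ x ^ m = c).card ≤ Nat.gcd m (p - 1) := by
  classical
  rcases (Finset.univ.filter fun x : ZMod p => x ≠ 0 ∧ x ^ m = c).eq_empty_or_nonempty with h | ⟨y, hy⟩
  · rw [h]; simp
  obtain ⟨hy0, hy1⟩ := (Finset.mem_filter.mp hy).2
  rw [← card_filter_pow_eq_one]
  refine Finset.card_le_card_of_injOn (fun x => x / y) ?_ ?_
  · intro x hx
    obtain ⟨hx0, hx1⟩ := (Finset.mem_filter.mp (Finset.mem_coe.mp hx)).2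
    simp only [Finset.coe_filter, Finset.mem_univ, true_and, Set.mem_ofPred_eq]
    exact ⟨div_ne_zero hx0 hy0, by rw [div_pow, hx1, hy1, div_self (hy1 ▸ pow_ne_zero m hy0)]⟩
  · intro x _ z _ h
    exact (div_left_inj' hy0).mp h

/-- The binomial exponential sum over the nonzero residues. -/
noncomputable def binomialSum (p k : ℕ) [Fact p.Prime] (a b : ZMod p) : ℂ :=
  ∑ x ∈ Finset.univ.filter (fun x : ZMod p => x ≠ 0), stdAddChar (a * x + b * x ^ k)

lemma binomialSum_scale {p k : ℕ} [Fact p.Prime] (a b : ZMod p) {u : ZMod p} (hu : u ≠ 0) :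
    binomialSum p k (a * u) (b * u ^ k) = binomialSum p k a b := by
  unfold binomialSum
  refine Finset.sum_bij (fun x _ => u * x) ?_ ?_ ?_ ?_
  · intro x hx; simp_all
  · intro x _ y _ h; exact mul_left_cancel₀ hu h
  · intro y hy
    refine ⟨y / u, ?_, mul_div_cancel₀ _ hu⟩
    simp_all
  · intro x _
    rw [mul_pow]; congr 1; ring

lemma pow_injective_of_gcd {p k : ℕ} [Fact p.Prime] (hk : 1 ≤ k) (hkp : Nat.gcd k (p - 1) = 1) :
    Function.Injective fun x : ZMod p => x ^ k := by
  intro x y h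
  simp only at h
  by_cases hy : y = 0
  · rw [hy, zero_pow (by omega)] at h
    rw [hy]; exact pow_eq_zero_iff (by omega) |>.mp h
  · have hx : x ≠ 0 := by
      rintro rfl
      rw [zero_pow (by omega)] at h
      exact hy (pow_eq_zero_iff (by omega) |>.mp h.symm)
    have h1 : (x / y) ^ Nat.gcd k (p - 1) = 1 := by
      rw [pow_gcd_eq_one]
      exact ⟨by rw [div_pow, h, div_self (pow_ne_zero _ hy)],
        ZMod.pow_card_sub_one_eq_one (div_ne_zero hx hy)⟩
    rw [hkp, pow_one, div_eq_one_iff_eq hy] at h1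
    exact h1

lemma card_pow_diff_le {p k : ℕ} [Fact p.Prime] {x : ℝ} (hx : 4 ≤ x) (hxp : x ^ 12 = p)
    (hk : 1 ≤ k) (hkp : Nat.gcd k (p - 1) = 1) {c : ZMod p} (hc : c ≠ 0) :
    (((Finset.univ.filter fun z : ZMod p => z ≠ 0 ∧ z + 1 ≠ 0 ∧ (z + 1) ^ k = z ^ k + c).card : ℕ)
      : ℝ) ≤ Nat.gcd (k - 1) (p - 1) + 19 * x ^ 10 := by
  classical
  refine le_trans ?_ (add_le_add (Nat.cast_le.mpr (card_filter_pow_eq_le (k - 1) c))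
    (card_powDiffSolutions_le hx hxp hk hkp hc))
  rw [← Nat.cast_add]
  refine Nat.cast_le.mpr (le_trans (Finset.card_le_card ?_) (Finset.card_union_le _ _))
  intro z hz
  simp only [powDiffSolutions, Finset.mem_union, Finset.mem_filter, Finset.mem_univ,
    true_and] at hz ⊢
  by_cases h : z ^ (k - 1) = c
  · exact Or.inl ⟨hz.1, h⟩
  · exact Or.inr ⟨hz.1, hz.2.1, hz.2.2, h⟩

lemma card_pairs_le {p k : ℕ} [Fact p.Prime] {L : ℝ}
    (hL : ∀ c : ZMod p, c ≠ 0 → (((Finset.univ.filter fun z : ZMod p =>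
      z ≠ 0 ∧ z + 1 ≠ 0 ∧ (z + 1) ^ k = z ^ k + c).card : ℕ) : ℝ) ≤ L) {m n : ZMod p} (hm : m ≠ 0)
    (hn : n ≠ 0) (U : Finset (ZMod p)) (hU : U = Finset.univ.filter fun x => x ≠ 0) :
    ((((U ×ˢ U).filter fun q : ZMod p × ZMod p => q.1 - q.2 = m ∧ q.1 ^ k - q.2 ^ k = n).card : ℕ)
      : ℝ) ≤ L := by
  classical
  refine le_trans (Nat.cast_le.mpr ?_) (hL (n / m ^ k) (div_ne_zero hn (pow_ne_zero _ hm)))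
  refine Finset.card_le_card_of_injOn (fun q => q.2 / m) ?_ ?_
  · rintro ⟨a, b⟩ hq
    simp only [hU, Finset.coe_filter, Finset.mem_product, Finset.mem_filter, Finset.mem_univ,
      true_and, Set.mem_ofPred_eq] at hq ⊢
    obtain ⟨⟨ha, hb⟩, h1, h2⟩ := hq
    have h3 : b / m + 1 = a / m := by field_simp; rw [← h1]; ring
    refine ⟨div_ne_zero hb hm, h3 ▸ div_ne_zero ha hm, ?_⟩
    rw [h3, div_pow, div_pow, ← add_div, ← h2]; congr 1; ring
  · rintro ⟨a, b⟩ hq ⟨a', b'⟩ hq' h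
    simp only [Finset.coe_filter, Set.mem_ofPred_eq] at hq hq'
    have hb : b = b' := (div_left_inj' hm).mp h
    have ha : a = a' := by linear_combination hq.2.1 - hq'.2.1 + hb
    rw [ha, hb]

/-- Fourth moment bound for binomial sums. -/
lemma norm_binomialSum_pow_four_le {p k : ℕ} [Fact p.Prime] {L : ℝ} (hL0 : 0 ≤ L) (hk : 1 ≤ k)
    (hkp : Nat.gcd k (p - 1) = 1)
    (hL : ∀ c : ZMod p, c ≠ 0 → (((Finset.univ.filter fun z : ZMod p =>
      z ≠ 0 ∧ z + 1 ≠ 0 ∧ (z + 1) ^ k = z ^ k + c).card : ℕ) : ℝ) ≤ L) {a b : ZMod p} (ha : a ≠ 0) :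
    ‖binomialSum p k a b‖ ^ 4 ≤ p ^ 3 * (L + 1) := by
  classical
  set U : Finset (ZMod p) := Finset.univ.filter fun x => x ≠ 0 with hU
  have hUc : U.card = p - 1 := card_filter_ne_zero p
  have hp := (Fact.out : p.Prime).one_lt
  have hp1 : (0 : ℝ) < ((p - 1 : ℕ) : ℝ) := by exact_mod_cast (by omega : 0 < p - 1)
  have hsq : ∀ a b : ZMod p, ‖∑ q ∈ U ×ˢ U, stdAddChar (a * (q.1 - q.2) + b * (q.1 ^ k - q.2 ^ k))‖
      = ‖binomialSum p k a b‖ ^ 2 := by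
    intro a b
    have h1 := ofReal_norm_sq_sum_char U (fun x => a * x + b * x ^ k)
    have h2 : ∑ q ∈ U ×ˢ U, stdAddChar (a * (q.1 - q.2) + b * (q.1 ^ k - q.2 ^ k))
        = ((‖binomialSum p k a b‖ ^ 2 : ℝ) : ℂ) := by
      rw [binomialSum, h1, Finset.sum_product]
      refine Finset.sum_congr rfl fun i _ => Finset.sum_congr rfl fun j _ => ?_
      congr 1; ring
    rw [h2, Complex.norm_real, Real.norm_of_nonneg (by positivity)]
  have hpars := sum_sum_norm_sq_sum_char (U ×ˢ U) (fun q : ZMod p × ZMod p => q.1 - q.2)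
    (fun q => q.1 ^ k - q.2 ^ k)
  simp only [hsq, ← pow_mul] at hpars
  norm_num at hpars
  have hlow : (p - 1 : ℕ) * ‖binomialSum p k a b‖ ^ 4
      ≤ ∑ a : ZMod p, ∑ b : ZMod p, ‖binomialSum p k a b‖ ^ 4 := by
    calc ((p - 1 : ℕ) : ℝ) * ‖binomialSum p k a b‖ ^ 4
        = ∑ u ∈ U, ‖binomialSum p k (a * u) (b * u ^ k)‖ ^ 4 := by
          rw [← hUc, ← nsmul_eq_mul, ← Finset.sum_const]
          refine Finset.sum_congr rfl fun u hu => ?_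
          rw [binomialSum_scale a b (Finset.mem_filter.mp hu).2]
      _ = ∑ q ∈ U.image fun u => (a * u, b * u ^ k), ‖binomialSum p k q.1 q.2‖ ^ 4 := by
          rw [Finset.sum_image]
          intro u _ v _ h
          exact mul_left_cancel₀ ha (congrArg Prod.fst h)
      _ ≤ ∑ q : ZMod p × ZMod p, ‖binomialSum p k q.1 q.2‖ ^ 4 :=
          Finset.sum_le_sum_of_subset_of_nonneg (Finset.subset_univ _) fun _ _ _ => by positivity
      _ = _ := Fintype.sum_prod_type _
  have hup : ∑ q ∈ U ×ˢ U, ((((U ×ˢ U).filter fun r : ZMod p × ZMod p =>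
      r.1 - r.2 = q.1 - q.2 ∧ r.1 ^ k - r.2 ^ k = q.1 ^ k - q.2 ^ k).card : ℕ) : ℝ)
      ≤ (p - 1 : ℕ) ^ 2 * (L + 1) := by
    have h1 : ∀ q ∈ U ×ˢ U, ((((U ×ˢ U).filter fun r : ZMod p × ZMod p =>
        r.1 - r.2 = q.1 - q.2 ∧ r.1 ^ k - r.2 ^ k = q.1 ^ k - q.2 ^ k).card : ℕ) : ℝ)
        ≤ L + if q.1 = q.2 then ((p - 1 : ℕ) : ℝ) else 0 := by
      rintro ⟨y, z⟩ hq
      by_cases hyz : y = z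
      · subst hyz
        simp only [sub_self, if_true]
        refine le_trans (Nat.cast_le.mpr ?_) (le_add_of_nonneg_left hL0)
        rw [← hUc]
        refine Finset.card_le_card_of_injOn (fun q => q.1) ?_ ?_
        · intro r hr
          exact Finset.mem_coe.mpr (Finset.mem_product.mp (Finset.mem_filter.mp hr).1).1
        · rintro ⟨c, d⟩ hr ⟨c', d'⟩ hr' h
          have h1 := (Finset.mem_filter.mp hr).2.1
          have h2 := (Finset.mem_filter.mp hr').2.1
          simp only at h h1 h2
          rw [Prod.mk.injEq]
          exact ⟨h, by linear_combination h - h1 + h2⟩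
      · simp only [hyz, if_false, add_zero]
        refine card_pairs_le hL (sub_ne_zero.mpr hyz) ?_ U hU
        exact sub_ne_zero.mpr fun h => hyz (pow_injective_of_gcd hk hkp h)
    refine (Finset.sum_le_sum h1).trans ?_
    rw [Finset.sum_add_distrib, Finset.sum_const, Finset.card_product, hUc, Finset.sum_product]
    have h2 : ∀ y ∈ U, ∑ z ∈ U, (if y = z then ((p - 1 : ℕ) : ℝ) else 0) = ((p - 1 : ℕ) : ℝ) := by
      intro y hy
      rw [Finset.sum_ite_eq, if_pos hy]
    rw [Finset.sum_congr rfl h2, Finset.sum_const, hUc]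
    simp only [nsmul_eq_mul]
    push_cast
    linarith
  have hfin : ((p - 1 : ℕ) : ℝ) * ‖binomialSum p k a b‖ ^ 4
      ≤ ((p - 1 : ℕ) : ℝ) * (p ^ 3 * (L + 1)) := by
    refine hlow.trans ?_
    rw [hpars]
    have h3 : ((p - 1 : ℕ) : ℝ) ≤ p := by exact_mod_cast Nat.sub_le p 1
    calc (p : ℝ) ^ 2 * _ ≤ (p : ℝ) ^ 2 * ((p - 1 : ℕ) ^ 2 * (L + 1)) := by gcongr
      _ = ((p - 1 : ℕ) : ℝ) * ((p : ℝ) ^ 2 * (p - 1 : ℕ) * (L + 1)) := by ring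
      _ ≤ ((p - 1 : ℕ) : ℝ) * ((p : ℝ) ^ 2 * p * (L + 1)) := by gcongr
      _ = _ := by ring
  exact le_of_mul_le_mul_left hfin hp1

lemma binomialSum_eq_sum_sub_one {p k : ℕ} [Fact p.Prime] (hk : 1 ≤ k) (a b : ZMod p) :
    binomialSum p k a b = ∑ x : ZMod p, stdAddChar (a * x + b * x ^ k) - 1 := by
  classical
  have h : (Finset.univ.filter fun x : ZMod p => x ≠ 0) = Finset.univ.erase 0 := by ext u; simp
  rw [binomialSum, h, ← Finset.sum_erase_add Finset.univ _ (Finset.mem_univ (0 : ZMod p)),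
    zero_pow (by omega)]
  simp

lemma binomialSum_zero_right {p k : ℕ} [Fact p.Prime] (hk : 1 ≤ k) {a : ZMod p} (ha : a ≠ 0) :
    binomialSum p k a 0 = -1 := by
  have h := sum_stdAddChar_mul a
  rw [if_neg ha] at h
  rw [binomialSum_eq_sum_sub_one hk]
  simp only [zero_mul, add_zero, mul_comm a]
  rw [h, zero_sub]

lemma binomialSum_zero_left {p k : ℕ} [Fact p.Prime] (hk : 1 ≤ k) (hkp : Nat.gcd k (p - 1) = 1)
    {b : ZMod p} (hb : b ≠ 0) : binomialSum p k 0 b = -1 := by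
  have h := sum_stdAddChar_mul b
  rw [if_neg hb] at h
  rw [binomialSum_eq_sum_sub_one hk]
  simp only [zero_mul, zero_add]
  have h1 := (Finite.injective_iff_bijective.mp (pow_injective_of_gcd hk hkp)).sum_comp
    (fun y : ZMod p => stdAddChar (b * y))
  rw [h1]
  simp only [mul_comm b]
  rw [h, zero_sub]

/-- Gauss' bound for exponential sums over a subgroup of roots of unity. -/
lemma norm_sq_sum_roots_le {p : ℕ} [Fact p.Prime] (m : ℕ) {y : ZMod p} (hy : y ≠ 0) :
    ‖∑ h ∈ Finset.univ.filter (fun h : ZMod p => h ≠ 0 ∧ h ^ m = 1), stdAddChar (y * h)‖ ^ 2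
      ≤ p := by
  classical
  set H := Finset.univ.filter (fun h : ZMod p => h ≠ 0 ∧ h ^ m = 1) with hH
  have hmem : ∀ h, h ∈ H ↔ h ≠ 0 ∧ h ^ m = 1 := by simp [hH]
  have hpos : (0 : ℝ) < H.card := by
    exact_mod_cast Finset.card_pos.mpr ⟨1, (hmem 1).mpr ⟨one_ne_zero, one_pow m⟩⟩
  have hinv : ∀ g ∈ H, ∑ h ∈ H, stdAddChar (y * g * h) = ∑ h ∈ H, stdAddChar (y * h) := by
    intro g hg
    obtain ⟨hg0, hg1⟩ := (hmem g).mp hg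
    refine Finset.sum_bij (fun h _ => g * h) ?_ ?_ ?_ ?_
    · intro h hh
      obtain ⟨hh0, hh1⟩ := (hmem h).mp hh
      exact (hmem _).mpr ⟨mul_ne_zero hg0 hh0, by rw [mul_pow, hg1, hh1, one_mul]⟩
    · intro _ _ _ _ h; exact mul_left_cancel₀ hg0 h
    · intro h hh
      obtain ⟨hh0, hh1⟩ := (hmem h).mp hh
      exact ⟨h / g, (hmem _).mpr ⟨div_ne_zero hh0 hg0, by rw [div_pow, hg1, hh1, div_one]⟩,
        mul_div_cancel₀ _ hg0⟩
    · intro h _; rw [mul_assoc]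
  have hpars := sum_norm_sq_sum_char H (fun h => h)
  have h1 : ∑ i ∈ H, (((H.filter fun j => j = i).card : ℕ) : ℝ) = H.card := by
    rw [Finset.sum_congr rfl (g := fun _ => (1 : ℝ))]
    · simp
    · intro i hi
      rw [Finset.filter_eq' H i, if_pos hi]; simp
  rw [h1] at hpars
  refine le_of_mul_le_mul_left ?_ hpos
  calc (H.card : ℝ) * ‖∑ h ∈ H, stdAddChar (y * h)‖ ^ 2
      = ∑ g ∈ H, ‖∑ h ∈ H, stdAddChar (y * g * h)‖ ^ 2 := by
        rw [← nsmul_eq_mul, ← Finset.sum_const]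
        exact Finset.sum_congr rfl fun g hg => by rw [hinv g hg]
    _ = ∑ a ∈ H.image (fun g => y * g), ‖∑ h ∈ H, stdAddChar (a * h)‖ ^ 2 := by
        rw [Finset.sum_image]
        intro _ _ _ _ h; exact mul_left_cancel₀ hy h
    _ ≤ ∑ a : ZMod p, ‖∑ h ∈ H, stdAddChar (a * h)‖ ^ 2 :=
        Finset.sum_le_sum_of_subset_of_nonneg (Finset.subset_univ _) fun _ _ _ => by positivity
    _ = _ := by rw [hpars, mul_comm]

lemma gcd_mul_norm_binomialSum_le {p k : ℕ} [Fact p.Prime] (hk : 1 ≤ k) (a : ZMod p) {b : ZMod p}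
    (hb : b ≠ 0) :
    (Nat.gcd (k - 1) (p - 1) : ℝ) * ‖binomialSum p k a b‖
      ≤ (Nat.gcd (k - 1) (p - 1) : ℝ) ^ 2 + p * √p := by
  classical
  set H := Finset.univ.filter (fun h : ZMod p => h ≠ 0 ∧ h ^ (k - 1) = 1) with hH
  have hHc : H.card = Nat.gcd (k - 1) (p - 1) := card_filter_pow_eq_one _
  set U : Finset (ZMod p) := Finset.univ.filter fun x => x ≠ 0 with hU
  have hk' : k = k - 1 + 1 := by omega
  have h1 : (H.card : ℂ) * binomialSum p k a b
      = ∑ x ∈ U, ∑ h ∈ H, stdAddChar ((a * x + b * x ^ k) * h) := by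
    rw [← nsmul_eq_mul, ← Finset.sum_const, Finset.sum_comm]
    refine Finset.sum_congr rfl fun h hh => ?_
    obtain ⟨hh0, hh1⟩ := (Finset.mem_filter.mp hh).2
    rw [← binomialSum_scale a b hh0, binomialSum]
    refine Finset.sum_congr rfl fun x _ => ?_
    congr 1
    have : h ^ k = h := by rw [hk', pow_succ, hh1, one_mul]
    rw [this]; ring
  have h2 : (H.card : ℝ) * ‖binomialSum p k a b‖
      ≤ ∑ x ∈ U, ‖∑ h ∈ H, stdAddChar ((a * x + b * x ^ k) * h)‖ := by
    have := congrArg norm h1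
    rw [norm_mul, Complex.norm_natCast] at this
    rw [this]; exact norm_sum_le _ _
  have h3 : ∀ x ∈ U, ‖∑ h ∈ H, stdAddChar ((a * x + b * x ^ k) * h)‖
      ≤ (if x ^ (k - 1) = -a / b then (H.card : ℝ) else 0) + √p := by
    intro x hx
    have hx0 := (Finset.mem_filter.mp hx).2
    by_cases h0 : a * x + b * x ^ k = 0
    · have : x ^ (k - 1) = -a / b := by
        rw [eq_div_iff hb]
        refine mul_right_cancel₀ hx0 ?_
        have h4 : x ^ k = x ^ (k - 1) * x := by rw [← pow_succ, ← hk']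
        rw [h4] at h0
        linear_combination h0
      rw [if_pos this, h0]
      simp
    · refine le_add_of_nonneg_of_le (ite_nonneg (Nat.cast_nonneg _) le_rfl) ?_
      exact Real.le_sqrt_of_sq_le (norm_sq_sum_roots_le _ h0)
  have h4 := h2.trans (Finset.sum_le_sum h3)
  rw [Finset.sum_add_distrib, ← Finset.sum_filter, Finset.sum_const, Finset.sum_const,
    card_filter_ne_zero, hU, Finset.filter_filter, hHc, nsmul_eq_mul, nsmul_eq_mul] at h4
  refine h4.trans (add_le_add ?_ ?_)
  · rw [sq]
    gcongr
    exact card_filter_pow_eq_le _ _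
  · gcongr
    exact Nat.sub_le p 1

/-- A uniform bound for nontrivial binomial sums when `gcd (k - 1) (p - 1)` is small. -/
lemma norm_binomialSum_pow_four_le_of_gcd_le {p k : ℕ} [Fact p.Prime] {x : ℝ} (hx : 4 ≤ x)
    (hxp : x ^ 12 = p) (hk : 1 ≤ k) (hkp : Nat.gcd k (p - 1) = 1)
    (hd : (Nat.gcd (k - 1) (p - 1) : ℝ) ≤ x ^ 10) {a b : ZMod p} (ha : a ≠ 0) :
    ‖binomialSum p k a b‖ ^ 4 ≤ 21 * x ^ 46 := by
  have hx0 : 0 < x := by linarith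
  have h := norm_binomialSum_pow_four_le (L := 20 * x ^ 10) (b := b) (by positivity) hk hkp
    (fun c hc => (card_pow_diff_le hx hxp hk hkp hc).trans (by linarith)) ha
  rw [← hxp] at h
  have h1 : (1 : ℝ) ≤ x ^ 10 := one_le_pow₀ (by linarith)
  calc _ ≤ _ := h
    _ ≤ (x ^ 12) ^ 3 * (20 * x ^ 10 + x ^ 10) := by gcongr
    _ = _ := by ring

lemma norm_binomialSum_le_of_le_gcd {p k : ℕ} [Fact p.Prime] {x : ℝ} (hx : 4 ≤ x)
    (hxp : x ^ 12 = p) (hk : 1 ≤ k)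
    (hd : x ^ 10 ≤ (Nat.gcd (k - 1) (p - 1) : ℝ)) (a : ZMod p) {b : ZMod p} (hb : b ≠ 0) :
    ‖binomialSum p k a b‖ ≤ Nat.gcd (k - 1) (p - 1) + x ^ 8 := by
  have hx0 : 0 < x := by linarith
  have h := gcd_mul_norm_binomialSum_le hk a hb
  have hs : √(p : ℝ) = x ^ 6 := by
    rw [← hxp, show x ^ 12 = (x ^ 6) ^ 2 by ring, Real.sqrt_sq (by positivity)]
  rw [hs, ← hxp] at h
  have hd0 : (0 : ℝ) < Nat.gcd (k - 1) (p - 1) := lt_of_lt_of_le (by positivity) hd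
  refine le_of_mul_le_mul_left (h.trans ?_) hd0
  have : x ^ 12 * x ^ 6 = x ^ 10 * x ^ 8 := by ring
  rw [mul_add, this, sq]
  gcongr

lemma sum_norm_sq_progression {p : ℕ} [Fact p.Prime] {c : ZMod p} (hc : c ≠ 0) {h : ℕ}
    (hh : h ≤ p) :
    ∑ a : ZMod p, ‖∑ m ∈ Finset.range h, stdAddChar (a * (c * (m : ZMod p)))‖ ^ 2 = p * h := by
  classical
  rw [sum_norm_sq_sum_char (Finset.range h) fun m => c * (m : ZMod p)]
  congr 1
  rw [Finset.sum_congr rfl (g := fun _ => (1 : ℝ))]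
  · simp
  · intro i hi
    have : ((Finset.range h).filter fun j : ℕ => c * (j : ZMod p) = c * i) = {i} := by
      ext j
      simp only [Finset.mem_filter, Finset.mem_range, Finset.mem_singleton]
      have hi' := Finset.mem_range.mp hi
      constructor
      · rintro ⟨hj, hji⟩
        have h1 := congrArg ZMod.val (mul_left_cancel₀ hc hji)
        rwa [ZMod.val_cast_of_lt (by omega), ZMod.val_cast_of_lt (by omega)] at h1
      · rintro rfl
        exact ⟨hi', rfl⟩
    rw [this]; simp

/-- The Fourier coefficient of the convolution square of an arithmetic progression. -/
lemma norm_sum_sum_progression {p : ℕ} [Fact p.Prime] (c x₀ a : ZMod p) (h : ℕ) :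
    ‖∑ q ∈ Finset.range h ×ˢ Finset.range h, stdAddChar (-a * (x₀ + c * ((q.1 + q.2 : ℕ) : ZMod p)))‖
      = ‖∑ m ∈ Finset.range h, stdAddChar (-a * (c * (m : ZMod p)))‖ ^ 2 := by
  have h1 : ∑ q ∈ Finset.range h ×ˢ Finset.range h, stdAddChar (-a * (x₀ + c * ((q.1 + q.2 : ℕ) : ZMod p)))
      = stdAddChar (-a * x₀) * (∑ m ∈ Finset.range h, stdAddChar (-a * (c * (m : ZMod p)))) ^ 2 := by
    rw [sq, Finset.sum_mul_sum, Finset.mul_sum, Finset.sum_product]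
    refine Finset.sum_congr rfl fun i _ => ?_
    rw [Finset.mul_sum]
    refine Finset.sum_congr rfl fun j _ => ?_
    rw [← AddChar.map_add_eq_mul, ← AddChar.map_add_eq_mul]
    congr 1
    push_cast
    ring
  rw [h1, norm_mul, norm_pow, AddChar.norm_apply, one_mul]

/-- Small exponential sums force the graph of `x ↦ A * x ^ k` to meet every box. -/
lemma exists_mem_box {p k : ℕ} [Fact p.Prime] {c : ZMod p} (hc : c ≠ 0) {A : ZMod p} (hA : A ≠ 0)
    {h : ℕ} (hhp : h ≤ p) {M : ℝ}
    (hM : ∀ a b : ZMod p, ¬ (a = 0 ∧ b = 0) → ‖binomialSum p k a b‖ ≤ M)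
    (hMh : M * p ^ 2 < ((p - 1 : ℕ) : ℝ) * h ^ 2) (x₀ y₀ : ZMod p) :
    ∃ x : ZMod p, ∃ q r : ℕ × ℕ, x ≠ 0 ∧ (q.1 < h ∧ q.2 < h) ∧ (r.1 < h ∧ r.2 < h) ∧
      x = x₀ + c * ((q.1 + q.2 : ℕ) : ZMod p) ∧ A * x ^ k = y₀ + c * ((r.1 + r.2 : ℕ) : ZMod p) := by
  classical
  by_contra! hno
  set U : Finset (ZMod p) := Finset.univ.filter fun x => x ≠ 0 with hU
  set J := Finset.range h ×ˢ Finset.range h with hJ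
  set K : ZMod p → ZMod p → ℂ := fun z a => ∑ q ∈ J, stdAddChar (-a * (z + c * ((q.1 + q.2 : ℕ) : ZMod p)))
    with hK
  have hM0 : 0 ≤ M := (norm_nonneg _).trans (hM 1 0 (by simp))
  have hh0 : (0 : ℝ) < (h : ℝ) ^ 2 := by
    by_contra h0
    have h1 : (h : ℝ) ^ 2 = 0 := le_antisymm (not_lt.mp h0) (by positivity)
    rw [h1, mul_zero] at hMh
    exact absurd hMh (not_lt.mpr (by positivity))
  have hsum : ∀ z : ZMod p, ∑ a : ZMod p, ‖K z a‖ = p * h := by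
    intro z
    simp only [hK, hJ, norm_sum_sum_progression]
    rw [← sum_norm_sq_progression hc hhp]
    exact Equiv.sum_comp (Equiv.neg (ZMod p))
      fun a : ZMod p => ‖∑ m ∈ Finset.range h, stdAddChar (a * (c * (m : ZMod p)))‖ ^ 2
  have hexp : ∀ a b : ZMod p, binomialSum p k a (b * A) * (K x₀ a * K y₀ b)
      = ∑ x ∈ U, ∑ q ∈ J, ∑ r ∈ J, stdAddChar (a * (x - (x₀ + c * ((q.1 + q.2 : ℕ) : ZMod p))))
          * stdAddChar (b * (A * x ^ k - (y₀ + c * ((r.1 + r.2 : ℕ) : ZMod p)))) := by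
    intro a b
    rw [binomialSum, Finset.sum_mul]
    refine Finset.sum_congr rfl fun x _ => ?_
    simp only [hK]
    rw [Finset.sum_mul_sum, Finset.mul_sum]
    refine Finset.sum_congr rfl fun q _ => ?_
    rw [Finset.mul_sum]
    refine Finset.sum_congr rfl fun r _ => ?_
    rw [← AddChar.map_add_eq_mul, ← AddChar.map_add_eq_mul, ← AddChar.map_add_eq_mul]
    congr 1
    ring
  have hzero : ∑ a : ZMod p, ∑ b : ZMod p, binomialSum p k a (b * A) * (K x₀ a * K y₀ b) = 0 := by
    rw [← Fintype.sum_prod_type']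
    simp only [hexp]
    rw [Finset.sum_comm]
    refine Finset.sum_eq_zero fun x hx => ?_
    rw [Finset.sum_comm]
    refine Finset.sum_eq_zero fun q hq => ?_
    rw [Finset.sum_comm]
    refine Finset.sum_eq_zero fun r hr => ?_
    rw [Fintype.sum_prod_type]
    simp only [← Finset.mul_sum, ← Finset.sum_mul, sum_stdAddChar_mul, sub_eq_zero]
    rw [hJ, Finset.mem_product, Finset.mem_range, Finset.mem_range] at hq hr
    by_cases h1 : x = x₀ + c * ((q.1 + q.2 : ℕ) : ZMod p)
    · rw [if_neg (hno x q r (Finset.mem_filter.mp hx).2 hq hr h1), mul_zero]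
    · rw [if_neg h1, zero_mul]
  have hS0 : binomialSum p k 0 (0 * A) = ((p - 1 : ℕ) : ℂ) := by
    rw [binomialSum, ← card_filter_ne_zero p]
    simp
  have hK0 : ∀ z, K z 0 = (h : ℂ) ^ 2 := by
    intro z
    simp [hK, hJ, sq]
  have hmain : ((p - 1 : ℕ) : ℝ) * h ^ 4 ≤ M * (p * h) ^ 2 := by
    rw [← Fintype.sum_prod_type' (f := fun a b => binomialSum p k a (b * A) * (K x₀ a * K y₀ b)),
      ← Finset.add_sum_erase _ _ (Finset.mem_univ ((0 : ZMod p), (0 : ZMod p)))] at hzero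
    have h1 := congrArg norm (eq_neg_of_add_eq_zero_left hzero)
    simp only at h1
    rw [norm_neg, hS0, hK0, hK0] at h1
    calc ((p - 1 : ℕ) : ℝ) * h ^ 4 = ‖((p - 1 : ℕ) : ℂ) * ((h : ℂ) ^ 2 * (h : ℂ) ^ 2)‖ := by
          rw [norm_mul, norm_mul, norm_pow, Complex.norm_natCast, Complex.norm_natCast]; ring
      _ ≤ ∑ q ∈ (Finset.univ : Finset (ZMod p × ZMod p)).erase (0, 0),
            ‖binomialSum p k q.1 (q.2 * A) * (K x₀ q.1 * K y₀ q.2)‖ := h1 ▸ norm_sum_le _ _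
      _ ≤ ∑ q ∈ (Finset.univ : Finset (ZMod p × ZMod p)).erase (0, 0),
            M * (‖K x₀ q.1‖ * ‖K y₀ q.2‖) := by
          refine Finset.sum_le_sum fun q hq => ?_
          rw [norm_mul, norm_mul]
          refine mul_le_mul_of_nonneg_right (hM _ _ ?_) (by positivity)
          rintro ⟨h2, h3⟩
          refine (Finset.mem_erase.mp hq).1 (Prod.ext h2 ?_)
          exact (mul_eq_zero.mp h3).resolve_right hA
      _ ≤ ∑ q : ZMod p × ZMod p, M * (‖K x₀ q.1‖ * ‖K y₀ q.2‖) :=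
          Finset.sum_le_sum_of_subset_of_nonneg (Finset.erase_subset _ _) fun _ _ _ => by positivity
      _ = M * (p * h) ^ 2 := by
          rw [← Finset.mul_sum, Fintype.sum_prod_type' (f := fun a b => ‖K x₀ a‖ * ‖K y₀ b‖),
            ← Finset.sum_mul_sum, hsum, hsum, sq]
  have h2 : (((p - 1 : ℕ) : ℝ) * h ^ 2) * h ^ 2 ≤ (M * p ^ 2) * h ^ 2 := by
    calc _ = ((p - 1 : ℕ) : ℝ) * h ^ 4 := by ring
      _ ≤ _ := hmain
      _ = _ := by ring
  exact absurd (le_of_mul_le_mul_right h2 hh0) (not_le.mpr hMh)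

end

lemma add_mul_mem_Iclass {p n i s : ℕ} (hnp : n < p) (hn : 2 ≤ n) (hi : i ≤ n - 1)
    (hs : s ≤ 2 * ((p - 1 - n) / (2 * n))) : (if i = 0 then n else i) + n * s ∈ Iclass p n i := by
  have h1 : n * s ≤ p - 1 - n :=
    calc n * s ≤ n * (2 * ((p - 1 - n) / (2 * n))) := Nat.mul_le_mul_left n hs
      _ = (2 * n) * ((p - 1 - n) / (2 * n)) := by ring
      _ ≤ _ := Nat.mul_div_le _ _
  simp only [Iclass, Finset.mem_filter, Finset.mem_Icc]
  refine ⟨⟨?_, ?_⟩, ?_⟩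
  · split_ifs <;> omega
  · split_ifs <;> omega
  · rw [Nat.add_mul_mod_self_left]
    split_ifs with h
    · rw [Nat.mod_self, h]
    · exact Nat.mod_eq_of_lt (by omega)

lemma image_Iclass_inter_nonempty {p n k : ℕ} [Fact p.Prime] {A : ℤ} (hA : ¬ (p : ℤ) ∣ A)
    (hn : 2 ≤ n) (hnp : n < p) (hk : 1 ≤ k) (hkp : Nat.gcd k (p - 1) = 1)
    (hpn : (1000 * n : ℝ) ≤ p) {M : ℝ} (hM1 : 1 ≤ M) (hM2 : M ≤ 0.24 * p / n ^ 2)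
    (hM : ∀ a b : ZMod p, a ≠ 0 → b ≠ 0 → ‖binomialSum p k a b‖ ≤ M) {i j : ℕ} (hi : i ≤ n - 1)
    (hj : j ≤ n - 1) : ((Iclass p n i).image (fmap p A k) ∩ Iclass p n j).Nonempty := by
  set t := (p - 1 - n) / (2 * n) with ht
  have hn0 : (0 : ℝ) < n := by exact_mod_cast (by omega : 0 < n)
  have hp0 : (0 : ℝ) < p := by exact_mod_cast (by omega : 0 < p)
  have hc : (n : ZMod p) ≠ 0 := by
    rw [Ne, ZMod.natCast_eq_zero_iff]
    exact fun h => absurd (Nat.le_of_dvd (by omega) h) (by omega)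
  have hA' : (A : ZMod p) ≠ 0 := by rwa [Ne, ZMod.intCast_zmod_eq_zero_iff_dvd]
  have ht1 : t + 1 ≤ p := by
    have : t ≤ p - 1 - n := Nat.div_le_self _ _
    omega
  have ht2 : 0.999 * p ≤ 2 * n * ((t + 1 : ℕ) : ℝ) := by
    have h1 : p - 1 - n < (2 * n) * (t + 1) := Nat.lt_mul_div_succ _ (by omega)
    have h2 : (p : ℝ) ≤ 2 * n * ((t + 1 : ℕ) : ℝ) + n := by
      exact_mod_cast (by omega : p ≤ 2 * n * (t + 1) + n)
    linarith
  have hMh : M * p ^ 2 < ((p - 1 : ℕ) : ℝ) * ((t + 1 : ℕ) : ℝ) ^ 2 := by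
    have h1 : 0.999 * (p : ℝ) ≤ ((p - 1 : ℕ) : ℝ) := by
      rw [Nat.cast_sub (by omega)]
      have : (2 : ℝ) ≤ n := by exact_mod_cast hn
      push_cast
      linarith
    have h2 : 0.999 * p / (2 * n) ≤ ((t + 1 : ℕ) : ℝ) := by
      rw [div_le_iff₀ (by positivity)]; linarith
    calc M * p ^ 2 ≤ (0.24 * p / n ^ 2) * p ^ 2 := by gcongr
      _ < (0.999 * (p : ℝ)) * (0.999 * (p : ℝ) / (2 * (n : ℝ))) ^ 2 := by
          rw [div_pow, ← sub_pos]
          have : (0.999 * (p : ℝ)) * ((0.999 * (p : ℝ)) ^ 2 / (2 * (n : ℝ)) ^ 2)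
              - (0.24 * (p : ℝ) / (n : ℝ) ^ 2) * (p : ℝ) ^ 2
            = (0.999 ^ 3 / 4 - 0.24) * (p ^ 3 / (n : ℝ) ^ 2) := by field_simp; ring
          rw [this]
          have : (0 : ℝ) < p ^ 3 / (n : ℝ) ^ 2 := by positivity
          norm_num
          exact this
      _ ≤ _ := by gcongr
  have hMall : ∀ a b : ZMod p, ¬ (a = 0 ∧ b = 0) → ‖binomialSum p k a b‖ ≤ M := by
    intro a b hab
    by_cases ha : a = 0
    · subst ha
      rw [binomialSum_zero_left hk hkp fun h => hab ⟨rfl, h⟩]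
      simpa using hM1
    · by_cases hb : b = 0
      · subst hb
        rw [binomialSum_zero_right hk ha]
        simpa using hM1
      · exact hM a b ha hb
  obtain ⟨x, q, r, -, hq, hr, hx, hy⟩ := exists_mem_box hc hA' ht1 hMall hMh
    (((if i = 0 then n else i : ℕ)) : ZMod p) (((if j = 0 then n else j : ℕ)) : ZMod p)
  have hX := add_mul_mem_Iclass hnp hn hi (s := q.1 + q.2) (by omega)
  have hY := add_mul_mem_Iclass hnp hn hj (s := r.1 + r.2) (by omega)
  refine ⟨_, Finset.mem_inter.mpr ⟨Finset.mem_image.mpr ⟨_, hX, ?_⟩, hY⟩⟩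
  have hY2 := (Finset.mem_Icc.mp (Finset.mem_filter.mp hY).1).2
  rw [fmap, Nat.cast_add, Nat.cast_mul, ← hx, hy, ← Nat.cast_mul, ← Nat.cast_add,
    ZMod.val_cast_of_lt (by omega)]

theorem stmt_15 (p n k : ℕ) (A : ℤ) (hp : p.Prime) (hodd : Odd p)
    (hA : 2 * |A| < (p : ℤ)) (hA0 : ¬ (p : ℤ) ∣ A)
    (hk1 : 1 ≤ k) (hk2 : k < p - 1) (hk3 : Nat.gcd k (p - 1) = 1)
    (hn : 2 ≤ n) (hnp : n < p)
    (hd : (Nat.gcd (k - 1) (p - 1) : ℝ) ≤ 0.006 * (p : ℝ) ^ ((89 : ℝ) / 92))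
    (hbig : (4 * 10 ^ 29 : ℝ) * (n : ℝ) ^ ((184 : ℝ) / 3) < (p : ℝ)) :
    ∀ i j : ℕ, i ≤ n - 1 → j ≤ n - 1 →
      ((Iclass p n i).image (fmap p A k) ∩ Iclass p n j).Nonempty := by
  intro i j hi hj
  have : Fact p.Prime := ⟨hp⟩
  have hn2 : (2 : ℝ) ≤ n := by exact_mod_cast hn
  have hn0 : (0 : ℝ) < n := by linarith
  have hp0 : (0 : ℝ) < p := by exact_mod_cast hp.pos
  obtain ⟨x, hx0, hxp⟩ : ∃ x : ℝ, 0 < x ∧ x ^ 12 = p := by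
    refine ⟨(p : ℝ) ^ ((1 : ℝ) / 12), by positivity, ?_⟩
    rw [← Real.rpow_natCast, ← Real.rpow_mul hp0.le]
    norm_num
  have hx : 600 * (n : ℝ) ^ 4 ≤ x := by
    have h1 : (8192 : ℝ) * (n : ℝ) ^ 48 ≤ (n : ℝ) ^ ((184 : ℝ) / 3) :=
      calc (8192 : ℝ) * (n : ℝ) ^ 48 = 2 ^ 13 * (n : ℝ) ^ 48 := by norm_num
        _ ≤ (n : ℝ) ^ 13 * (n : ℝ) ^ 48 := by gcongr
        _ = (n : ℝ) ^ (61 : ℝ) := by rw [← pow_add]; norm_cast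
        _ ≤ _ := Real.rpow_le_rpow_of_exponent_le (by linarith) (by norm_num)
    refine le_of_pow_le_pow_left₀ (n := 12) (by norm_num) hx0.le ?_
    rw [hxp, mul_pow, ← pow_mul]
    have h2 : (0 : ℝ) < (n : ℝ) ^ 48 := by positivity
    norm_num at hbig ⊢
    linarith
  have hn4 : (n : ℝ) * 2 ^ 3 ≤ (n : ℝ) ^ 4 :=
    calc (n : ℝ) * 2 ^ 3 ≤ n * (n : ℝ) ^ 3 := by gcongr
      _ = _ := by ring
  have hx4 : 4 ≤ x := by linarith
  have hx1 : (1 : ℝ) ≤ x := by linarith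
  have hpn : (1000 * n : ℝ) ≤ p := by
    have : x ≤ x ^ 12 := le_self_pow₀ hx1 (by norm_num)
    linarith
  have hx2 : 360000 * (n : ℝ) ^ 8 ≤ x ^ 2 :=
    calc 360000 * (n : ℝ) ^ 8 = (600 * (n : ℝ) ^ 4) ^ 2 := by ring
      _ ≤ _ := by gcongr
  have hn8 : (n : ℝ) ^ 2 ≤ (n : ℝ) ^ 8 := pow_le_pow_right₀ (by linarith) (by norm_num)
  have hxn : 360000 ≤ x ^ 2 / n ^ 2 := by
    rw [le_div_iff₀ (by positivity)]
    linarith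
  have hx10 : (1 : ℝ) ≤ x ^ 10 := one_le_pow₀ hx1
  have hx8 : (1 : ℝ) ≤ x ^ 8 := one_le_pow₀ hx1
  refine image_Iclass_inter_nonempty hA0 hn hnp hk1 hk3 hpn (M := 0.24 * p / n ^ 2) ?_ le_rfl ?_ hi
    hj
  · calc (1 : ℝ) ≤ 0.24 * (x ^ 10 * (x ^ 2 / n ^ 2)) := by nlinarith
      _ = _ := by rw [← hxp]; ring
  intro a b ha hb
  rcases le_total (Nat.gcd (k - 1) (p - 1) : ℝ) (x ^ 10) with hsmall | hlarge
  · have h := norm_binomialSum_pow_four_le_of_gcd_le hx4 hxp hk1 hk3 hsmall (b := b) ha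
    refine le_of_pow_le_pow_left₀ (n := 4) (by norm_num) (by positivity) (h.trans ?_)
    rw [← hxp, div_pow, le_div_iff₀ (by positivity)]
    calc 21 * x ^ 46 * ((n : ℝ) ^ 2) ^ 4 = 21 * x ^ 46 * (n : ℝ) ^ 8 := by ring
      _ ≤ 21 * x ^ 46 * (x ^ 2 / 360000) := by gcongr; linarith
      _ = 21 / 360000 * x ^ 48 := by ring
      _ ≤ 0.24 ^ 4 * x ^ 48 := by gcongr; norm_num
      _ = _ := by ring
  · have h := norm_binomialSum_le_of_le_gcd hx4 hxp hk1 hlarge a hb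
    have h1 : (n : ℝ) ^ 2 ≤ (p : ℝ) ^ ((3 : ℝ) / 92) :=
      calc (n : ℝ) ^ 2 = ((n : ℝ) ^ ((184 : ℝ) / 3)) ^ ((3 : ℝ) / 92) := by
            rw [← Real.rpow_mul hn0.le]; norm_num
        _ ≤ _ := by
            have : (0 : ℝ) ≤ (n : ℝ) ^ ((184 : ℝ) / 3) := by positivity
            gcongr
            linarith
    have h2 : (p : ℝ) ^ ((89 : ℝ) / 92) ≤ p / n ^ 2 := by
      rw [le_div_iff₀ (by positivity)]
      calc (p : ℝ) ^ ((89 : ℝ) / 92) * n ^ 2 ≤ (p : ℝ) ^ ((89 : ℝ) / 92) * (p : ℝ) ^ ((3 : ℝ) / 92) := by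
            gcongr
        _ = p := by rw [← Real.rpow_add hp0]; norm_num
    have h3 : x ^ 8 ≤ 0.1 * (p / n ^ 2) := by
      have h4 : (1 : ℝ) ≤ x ^ 2 := one_le_pow₀ hx1
      calc x ^ 8 = x ^ 8 * 1 := by ring
        _ ≤ x ^ 8 * (0.1 * (x ^ 2 * (x ^ 2 / n ^ 2))) := by gcongr; nlinarith
        _ = _ := by rw [← hxp]; ring
    have h5 : (0 : ℝ) ≤ p / (n : ℝ) ^ 2 := by positivity
    rw [mul_div_assoc]
    linarith
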